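/- arXiv:2106.01524 — 2 statements merged into one kernel-verified Lean document; each statement's English description precedes it below -/
import Mathlib

section
/- Let K be a Euclidean cubical complex in ℝⁿ with a minimum vertex w. If for every vertex v of K with v ≠ w the geometric realization of pastlk(K, v) is contractible, then for every vertex k of K the dipath space P(K, w, k) is contractible. -/
open Set

namespace DCC

/-- The real point corresponding to an integer point of `ℤⁿ`. -/
def toR {n : ℕ} (v : Fin n → ℤ) : Fin n → ℝ := fun i => (v i : ℝ)

/-- `j ∈ {0,1}ⁿ`: every coordinate of `j` is `0` or `1`. -/
def IsBinary {n : ℕ} (j : Fin n → ℤ) : Prop := ∀ i, j i = 0 ∨ j i = 1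

/-- The elementary cube `[v - j, v] = {x : v - j ⪯ x ⪯ v}` in `ℝⁿ`. -/
def cube {n : ℕ} (v j : Fin n → ℤ) : Set (Fin n → ℝ) := Set.Icc (toR (v - j)) (toR v)

/-- A subset of `ℝⁿ` which is an elementary cube. -/
def IsElemCube {n : ℕ} (σ : Set (Fin n → ℝ)) : Prop := ∃ v j, IsBinary j ∧ σ = cube v j

/-- A Euclidean cubical complex: a finite union of elementary cubes. -/
def IsComplex {n : ℕ} (K : Set (Fin n → ℝ)) : Prop :=
  ∃ C : Finset ((Fin n → ℤ) × (Fin n → ℤ)),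
    (∀ c ∈ C, IsBinary c.2) ∧ K = ⋃ c ∈ C, cube c.1 c.2

/-- The past link of `v` in `K`: all nonzero binary `j` with `[v - j, v] ⊆ K`. -/
def pastlk {n : ℕ} (K : Set (Fin n → ℝ)) (v : Fin n → ℤ) : Set (Fin n → ℤ) :=
  {j | IsBinary j ∧ j ≠ 0 ∧ cube v j ⊆ K}

/-- A maximal cube of `K`: a cube of `K` not properly contained in another cube of `K`. -/
def IsMaximalCube {n : ℕ} (K σ : Set (Fin n → ℝ)) : Prop :=
  IsElemCube σ ∧ σ ⊆ K ∧ ∀ γ, IsElemCube γ → γ ⊆ K → σ ⊆ γ → γ = σ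

/-- `τ` is a free face of the maximal cube `σ` in `K`: `τ` is a proper face of `σ` and
`σ` is the unique maximal cube of `K` containing `τ`. -/
def IsFreeFace {n : ℕ} (K τ σ : Set (Fin n → ℝ)) : Prop :=
  IsElemCube τ ∧ τ ⊂ σ ∧ IsMaximalCube K σ ∧
    ∀ γ, IsMaximalCube K γ → τ ⊆ γ → γ = σ

/-- The `(τ, σ)`-collapse of `K`: the union of all cubes of `K` that do not contain `τ`. -/
def collapse {n : ℕ} (K τ : Set (Fin n → ℝ)) : Set (Fin n → ℝ) :=
  ⋃₀ {γ | IsElemCube γ ∧ γ ⊆ K ∧ ¬ τ ⊆ γ}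

/-- The restriction `K|_σ` where `σ` has minimum vertex `a` and maximum vertex `b`:
the union of all cubes `γ` of `K` with `a ⪯ min γ` and `max γ ⪯ b`. -/
def restrict {n : ℕ} (K : Set (Fin n → ℝ)) (a b : Fin n → ℤ) : Set (Fin n → ℝ) :=
  ⋃₀ {γ | ∃ v j, IsBinary j ∧ γ = cube v j ∧ cube v j ⊆ K ∧ a ≤ v - j ∧ v ≤ b}

/-- The geometric realization of the past link of `v` in `K`, as a subset of `ℝⁿ`:
the union over `j ∈ pastlk K v` of the convex hulls of `{v - eᵢ : jᵢ = 1}`. -/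
def geomReal {n : ℕ} (K : Set (Fin n → ℝ)) (v : Fin n → ℤ) : Set (Fin n → ℝ) :=
  ⋃ j ∈ pastlk K v, convexHull ℝ ((fun i => toR v - Pi.single i (1 : ℝ)) '' {i | j i = 1})

/-- The space of dipaths in `K` from `p` to `q`, as a subspace of
`C([0,1], ℝⁿ)` with the compact-open topology. -/
def DipathSpace {n : ℕ} (K : Set (Fin n → ℝ)) (p q : Fin n → ℝ) :
    Set C(unitInterval, Fin n → ℝ) :=
  {γ | (∀ t, γ t ∈ K) ∧ γ 0 = p ∧ γ 1 = q ∧ Monotone ⇑γ}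

/-- The reachable complex `R(K, p)`: points of `K` reachable from `p` by a dipath in `K`. -/
def reach {n : ℕ} (K : Set (Fin n → ℝ)) (p : Fin n → ℝ) : Set (Fin n → ℝ) :=
  {q ∈ K | (DipathSpace K p q).Nonempty}

/-- `(τ, σ)` is an LPDC pair in `K` (where `K'` is the `(τ,σ)`-collapse of `K`):
for every vertex `v` of `K'`, the geometric realizations of the past links of `v`
in `K` and in `K'` are homotopy equivalent. -/
def IsLPDCPair {n : ℕ} (K τ : Set (Fin n → ℝ)) : Prop :=
  ∀ v : Fin n → ℤ, toR v ∈ collapse K τ →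
    Nonempty (ContinuousMap.HomotopyEquiv ↥(geomReal K v) ↥(geomReal (collapse K τ) v))


/-! ### An explicit nerve lemma -/

section Nerve

open ContinuousMap Topology

/-- Total version of a contraction of a subspace. -/
theorem exists_contraction {X : Type*} [TopologicalSpace X] (W : Set X) [ContractibleSpace W] :
    ∃ (D : X × ℝ → X) (b : X), ContinuousOn D (W ×ˢ univ) ∧ (∀ x ∈ W, ∀ t ≤ 0, D (x, t) = x) ∧
      (∀ x ∈ W, ∀ t, 1 ≤ t → D (x, t) = b) ∧ (∀ x ∈ W, ∀ t, D (x, t) ∈ W) := by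
  classical
  obtain ⟨b, ⟨H⟩⟩ := id_nullhomotopic W
  refine ⟨fun p => if h : p.1 ∈ W then (H (projIcc 0 1 zero_le_one p.2, ⟨p.1, h⟩) : X) else p.1,
    b, ?_, ?_, ?_, ?_⟩
  · rw [continuousOn_iff_continuous_domRestrict]
    have : Continuous fun q : ↥(W ×ˢ (univ : Set ℝ)) =>
        ((H (projIcc 0 1 zero_le_one q.1.2, ⟨q.1.1, q.2.1⟩) : W) : X) := by
      refine continuous_subtype_val.comp (H.continuous.comp ?_)
      refine Continuous.prodMk ?_ ?_
      · exact continuous_projIcc.comp (continuous_snd.comp continuous_subtype_val)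
      · exact Continuous.subtype_mk (continuous_fst.comp continuous_subtype_val) _
    refine this.congr ?_
    rintro ⟨⟨x, t⟩, hx⟩
    have hx' : x ∈ W := hx.1
    simp [hx']
  · intro x hx t ht
    simp only [hx, dite_true]
    rw [projIcc_of_le_left _ ht]
    have := H.apply_zero ⟨x, hx⟩
    exact congrArg Subtype.val this
  · intro x hx t ht
    simp only [hx, dite_true]
    rw [projIcc_of_right_le _ ht]
    have := H.apply_one ⟨x, hx⟩
    exact congrArg Subtype.val this
  · intro x hx t
    simp only [hx, dite_true]
    exact Subtype.coe_prop _

variable {ι X S : Type*} [TopologicalSpace X] [TopologicalSpace S]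

open Classical in
/-- One step of the folding process. -/
noncomputable def nstep (g : ι → S → ℝ) (D : ι → X × ℝ → X) (δ : ℝ) (z : S) (τ : ℝ) (x : X)
    (j : ι) : X :=
  if δ ≤ g j z then D j (x, τ * ((g j z - δ) / δ)) else x

/-- The folding process. -/
noncomputable def nfold (g : ι → S → ℝ) (D : ι → X × ℝ → X) (δ : ℝ) (l : List ι) (z : S) (τ : ℝ)
    (x : X) : X :=
  l.foldl (nstep g D δ z τ) x

/-- Hypotheses on the local contractions. -/
structure NData (W : ι → Set X) (g : ι → S → ℝ) (D : ι → X × ℝ → X) (b : ι → X) (δ : ℝ) :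
    Prop where
  pos : 0 < δ
  cg : ∀ j, Continuous (g j)
  cD : ∀ j z, δ ≤ g j z → ContinuousOn (D j) (W j ×ˢ univ)
  zero : ∀ j z, δ ≤ g j z → ∀ x ∈ W j, ∀ t ≤ 0, D j (x, t) = x
  one : ∀ j z, δ ≤ g j z → ∀ x ∈ W j, ∀ t, 1 ≤ t → D j (x, t) = b j
  mem : ∀ j z, δ ≤ g j z → ∀ x ∈ W j, ∀ t, D j (x, t) ∈ W j

/-- Compatibility of a point with a list of sets. -/
def NCompat (W : ι → Set X) (g : ι → S → ℝ) (δ : ℝ) (l : List ι) (z : S) (x : X) : Prop :=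
  ∀ j ∈ l, δ ≤ g j z → x ∈ W j

/-- Sortedness. -/
def NSorted (W : ι → Set X) (g : ι → S → ℝ) (δ : ℝ) (l : List ι) : Prop :=
  l.Pairwise fun j j' => ∀ z, δ ≤ g j z → δ ≤ g j' z → W j ⊆ W j'

variable {W : ι → Set X} {g : ι → S → ℝ} {D : ι → X × ℝ → X} {b : ι → X} {δ : ℝ}

theorem NCompat.step (h : NData W g D b δ) {j : ι} {l : List ι} (hl : NSorted W g δ (j :: l))
    {z : S} {x : X} (hx : NCompat W g δ (j :: l) z x) (τ : ℝ) :
    NCompat W g δ l z (nstep g D δ z τ x j) := by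
  intro j' hj' hg'
  unfold nstep
  split_ifs with hg
  · exact (List.pairwise_cons.1 hl).1 j' hj' z hg hg'
      (h.mem j z hg x (hx j (by simp) hg) _)
  · exact hx j' (by simp [hj']) hg'

theorem nstep_continuous (h : NData W g D b δ) {Z : Type*} [TopologicalSpace Z] (j : ι)
    {z : Z → S} {τ : Z → ℝ} {x : Z → X} (hz : Continuous z) (hτ : Continuous τ)
    (hx : Continuous x) (hc : ∀ a, δ ≤ g j (z a) → x a ∈ W j) :
    Continuous fun a => nstep g D δ (z a) (τ a) (x a) j := by
  classical
  have hgz : Continuous fun a => g j (z a) := (h.cg j).comp hz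
  unfold nstep
  refine continuous_if ?_ ?_ ?_
  · intro a ha
    have : δ = g j (z a) := frontier_le_subset_eq continuous_const hgz ha
    have h0 : τ a * ((g j (z a) - δ) / δ) = 0 := by rw [← this]; simp
    rw [h0]
    exact h.zero j (z a) this.le _ (hc a this.le) 0 le_rfl
  · rw [(isClosed_le continuous_const hgz).closure_eq]
    rcases isEmpty_or_nonempty {a | δ ≤ g j (z a)} with he | ⟨⟨a0, ha0⟩⟩
    · rw [Set.isEmpty_coe_sort.1 he]; exact continuousOn_empty _
    · refine (h.cD j (z a0) ha0).comp (t := W j ×ˢ univ) (f := fun a => (x a, _)) ?_ ?_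
      · refine Continuous.continuousOn ?_
        refine hx.prodMk (hτ.mul ((hgz.sub continuous_const).div_const _))
      · intro a ha
        exact ⟨hc a ha, trivial⟩
  · exact hx.continuousOn

theorem nfold_continuous (h : NData W g D b δ) {Z : Type*} [TopologicalSpace Z]
    {z : Z → S} {τ : Z → ℝ} (hz : Continuous z) (hτ : Continuous τ) (l : List ι)
    (hl : NSorted W g δ l) : ∀ {x : Z → X} (_ : Continuous x)
    (_ : ∀ a, NCompat W g δ l (z a) (x a)),
    Continuous fun a => nfold g D δ l (z a) (τ a) (x a) := by
  induction l with
  | nil => intro x hx _; exact hx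
  | cons j l ih =>
    intro x hx hc
    exact ih (List.pairwise_cons.1 hl).2
      (nstep_continuous h j hz hτ hx fun a => hc a j (by simp))
      fun a => (hc a).step h hl _

theorem nfold_zero (h : NData W g D b δ) (z : S) (l : List ι) :
    ∀ {x : X} (_ : NCompat W g δ l z x), nfold g D δ l z 0 x = x := by
  induction l with
  | nil => intro x _; rfl
  | cons j l ih =>
    intro x hc
    have : nstep g D δ z 0 x j = x := by
      unfold nstep
      split_ifs with hg
      · exact h.zero j z hg x (hc j (by simp) hg) _ (by simp)
      · rfl
    change nfold g D δ l z 0 (nstep g D δ z 0 x j) = x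
    rw [this]
    exact ih fun j' hj' => hc j' (by simp [hj'])

theorem nstep_one (h : NData W g D b δ) {z : S} {j : ι} (hj : 2 * δ ≤ g j z) {x : X}
    (hx : x ∈ W j) : nstep g D δ z 1 x j = b j := by
  have hp := h.pos
  have hg : δ ≤ g j z := by linarith
  unfold nstep
  rw [if_pos hg]
  refine h.one j z hg x hx _ ?_
  rw [one_mul, le_div_iff₀ hp]; linarith

theorem nfold_indep (h : NData W g D b δ) {z : S} {j : ι} (hj : 2 * δ ≤ g j z) (l : List ι)
    (hl : NSorted W g δ l) (hjl : j ∈ l) : ∀ {x x' : X} (_ : NCompat W g δ l z x)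
    (_ : NCompat W g δ l z x'), nfold g D δ l z 1 x = nfold g D δ l z 1 x' := by
  have hp := h.pos
  induction l with
  | nil => simp at hjl
  | cons i l ih =>
    intro x x' hx hx'
    change nfold g D δ l z 1 (nstep g D δ z 1 x i) = nfold g D δ l z 1 (nstep g D δ z 1 x' i)
    by_cases hij : j = i
    · subst hij
      rw [nstep_one h hj (hx j (by simp) (by linarith)),
        nstep_one h hj (hx' j (by simp) (by linarith))]
    · exact ih (List.pairwise_cons.1 hl).2 (by simpa [hij] using hjl) (hx.step h hl _)
        (hx'.step h hl _)

theorem nfold_continuous' (h : NData W g D b δ) {Z : Type*} [TopologicalSpace Z] {z : Z → S}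
    (hz : Continuous z) {j : ι} (hj : ∀ a, 2 * δ ≤ g j (z a)) (l : List ι)
    (hl : NSorted W g δ l) (hjl : j ∈ l) : ∀ {x : Z → X}
    (_ : ∀ a, NCompat W g δ l (z a) (x a)),
    Continuous fun a => nfold g D δ l (z a) 1 (x a) := by
  have hp := h.pos
  induction l with
  | nil => simp at hjl
  | cons i l ih =>
    intro x hx
    change Continuous fun a => nfold g D δ l (z a) 1 (nstep g D δ (z a) 1 (x a) i)
    by_cases hij : j = i
    · subst hij
      have he : ∀ a, nstep g D δ (z a) 1 (x a) j = b j := fun a =>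
        nstep_one h (hj a) (hx a j (by simp) (by linarith [hj a]))
      refine nfold_continuous h hz continuous_const l (List.pairwise_cons.1 hl).2 ?_ ?_
      · simp only [he]; exact continuous_const
      · exact fun a => (hx a).step h hl _
    · exact ih (List.pairwise_cons.1 hl).2 (by simpa [hij] using hjl) fun a => (hx a).step h hl _

/-- Abstract contraction principle. -/
theorem contractible_of_ndata [ContractibleSpace S] (h : NData W g D b δ) (l : List ι)
    (hl : NSorted W g δ l) (hcov : ∀ z, ∃ j ∈ l, 2 * δ ≤ g j z) (p : C(X, S))
    (hp : ∀ x, NCompat W g δ l (p x) x) (hne : ∀ z, ∃ x, NCompat W g δ l z x) :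
    ContractibleSpace X := by
  choose c hc using hne
  have : Finite {j // j ∈ l} := l.finite_toSet
  have hs : Continuous fun z => nfold g D δ l z 1 (c z) := by
    refine LocallyFinite.continuous (f := fun j : {j // j ∈ l} => {z | 2 * δ ≤ g j z})
      (locallyFinite_of_finite _) ?_ ?_ ?_
    · ext z
      obtain ⟨j, hj, hz⟩ := hcov z
      simp only [mem_iUnion, mem_univ, iff_true]
      exact ⟨⟨j, hj⟩, hz⟩
    · intro j
      exact isClosed_le continuous_const (h.cg _)
    · rintro ⟨j, hj⟩
      rw [continuousOn_iff_continuous_domRestrict]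
      exact nfold_continuous' h (z := fun a : {z | 2 * δ ≤ g j z} => (a : S))
        continuous_subtype_val (j := j) (fun a => a.2) l hl hj (x := fun a => c a) fun a => hc a
  let s : C(S, X) := ⟨_, hs⟩
  rw [contractible_iff_id_nullhomotopic]
  have H : Homotopic (ContinuousMap.id X) (s.comp p) := by
    refine ⟨⟨⟨fun a => nfold g D δ l (p a.2) (a.1 : ℝ) a.2, ?_⟩, ?_, ?_⟩⟩
    · exact nfold_continuous h (p.continuous.comp continuous_snd)
        (continuous_subtype_val.comp continuous_fst) l hl continuous_snd fun a => hp a.2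
    · intro x
      simpa using nfold_zero h (p x) l (hp x)
    · intro x
      obtain ⟨j, hj, hz⟩ := hcov (p x)
      simpa [s] using nfold_indep h hz l hl hj (hp x) (hc (p x))
  obtain ⟨y, hy⟩ := ((id_nullhomotopic S).comp_right s).comp_left p
  exact ⟨y, H.trans hy⟩

end Nerve

section Gap

/-- The gap function: how far the coordinates in `j` exceed the others (and zero). -/
noncomputable def gap {n : ℕ} (j : Finset (Fin n)) (x : Fin n → ℝ) : ℝ :=
  if h : j.Nonempty then
    j.inf' h (fun i => x i) -
      (insert none (jᶜ.image some)).sup' (Finset.insert_nonempty _ _) (fun o => o.elim 0 x)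
  else 0

theorem gap_continuous {n : ℕ} (j : Finset (Fin n)) : Continuous (gap j) := by
  unfold gap
  split_ifs with h
  · refine Continuous.sub ?_ ?_
    · exact Continuous.finset_inf'_apply _ fun i _ => continuous_apply i
    · refine Continuous.finset_sup'_apply _ fun o _ => ?_
      cases o
      · exact continuous_const
      · exact continuous_apply _
  · exact continuous_const

theorem le_gap_iff {n : ℕ} {j : Finset (Fin n)} (hj : j.Nonempty) (x : Fin n → ℝ) (δ : ℝ) :
    δ ≤ gap j x ↔ ∀ i ∈ j, δ ≤ x i ∧ ∀ i' ∉ j, x i' + δ ≤ x i := by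
  unfold gap
  rw [dif_pos hj, le_sub_iff_add_le', Finset.le_inf'_iff]
  refine forall₂_congr fun i _ => ?_
  rw [← le_sub_iff_add_le, Finset.sup'_le_iff]
  simp [le_sub_iff_add_le]

theorem nonempty_of_gap {n : ℕ} {j : Finset (Fin n)} {x : Fin n → ℝ} {δ : ℝ} (hδ : 0 < δ)
    (h : δ ≤ gap j x) : j.Nonempty := by
  by_contra hj
  unfold gap at h
  rw [dif_neg hj] at h
  linarith

theorem gap_subset {n : ℕ} {j j' : Finset (Fin n)} {x : Fin n → ℝ} {δ : ℝ} (hδ : 0 < δ)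
    (h : δ ≤ gap j x) (h' : δ ≤ gap j' x) (hc : j'.card ≤ j.card) : j' ⊆ j := by
  have h1 := (le_gap_iff (nonempty_of_gap hδ h) x δ).1 h
  have h2 := (le_gap_iff (nonempty_of_gap hδ h') x δ).1 h'
  by_contra hs
  obtain ⟨a, ha', ha⟩ := Finset.not_subset.1 hs
  have : j ⊆ j' := by
    intro c hcj
    by_contra hcj'
    have e1 := (h1 c hcj).2 a ha
    have e2 := (h2 a ha').2 c hcj'
    linarith
  exact ha (Finset.eq_of_subset_of_card_le this hc ▸ ha')

theorem exists_gap {n : ℕ} (x : Fin n → ℝ) (h0 : ∀ i, 0 ≤ x i) (h1 : ∑ i, x i = 1) :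
    ∃ j : Finset (Fin n), j.Nonempty ∧ 1 / ((n : ℝ) * (n + 1)) ≤ gap j x := by
  classical
  have hn : 0 < n := by
    rcases Nat.eq_zero_or_pos n with rfl | h
    · simp at h1
    · exact h
  have hn' : (0 : ℝ) < n := by exact_mod_cast hn
  set d : ℝ := 1 / ((n : ℝ) * (n + 1)) with hd
  have hdp : 0 < d := by positivity
  obtain ⟨i0, hi0⟩ : ∃ i, 1 / (n : ℝ) ≤ x i := by
    by_contra! hcon
    have : ∑ i, x i < ∑ i : Fin n, 1 / (n : ℝ) :=
      Finset.sum_lt_sum_of_nonempty ⟨⟨0, hn⟩, Finset.mem_univ _⟩ fun i _ => hcon i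
    rw [h1] at this
    simp [hn'.ne'] at this
  obtain ⟨m, hm, hmn⟩ := Finset.exists_mem_notMem_of_card_lt_card
    (s := Finset.univ.image fun i => ⌊x i / d⌋₊) (t := Finset.range (n + 1)) (by
      rw [Finset.card_range]
      exact lt_of_le_of_lt Finset.card_image_le (by simp))
  have hmn' : ∀ i, ⌊x i / d⌋₊ ≠ m := by
    intro i hi
    exact hmn (Finset.mem_image.2 ⟨i, Finset.mem_univ _, hi⟩)
  have hm' : (m : ℝ) + 1 ≤ n + 1 := by
    have : m + 1 ≤ n + 1 := by simpa using hm
    exact_mod_cast this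
  have key : ((n : ℝ) + 1) * d = 1 / n := by rw [hd]; field_simp
  let j : Finset (Fin n) := Finset.univ.filter fun i => m < ⌊x i / d⌋₊
  have hjm : ∀ i, i ∈ j → (m + 1) * d ≤ x i := by
    intro i hi
    have : m + 1 ≤ ⌊x i / d⌋₊ := by simpa [j] using hi
    have := (Nat.le_floor_iff (div_nonneg (h0 i) hdp.le)).1 this
    rw [le_div_iff₀ hdp] at this
    push_cast at this
    exact this
  have hjm' : ∀ i, i ∉ j → x i ≤ m * d := by
    intro i hi
    have h2 : ⌊x i / d⌋₊ ≤ m := by simpa [j] using hi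
    have h3 : ⌊x i / d⌋₊ < m := lt_of_le_of_ne h2 (hmn' i)
    have := (Nat.floor_lt (div_nonneg (h0 i) hdp.le)).1 h3
    rw [div_lt_iff₀ hdp] at this
    exact this.le
  have hi0j : i0 ∈ j := by
    by_contra hcon
    have := hjm' i0 hcon
    nlinarith
  refine ⟨j, ⟨i0, hi0j⟩, (le_gap_iff ⟨i0, hi0j⟩ x d).2 fun i hi => ⟨?_, fun i' hi' => ?_⟩⟩
  · have := hjm i hi
    have : 0 ≤ (m : ℝ) * d := by positivity
    nlinarith
  · have := hjm i hi
    have := hjm' i' hi'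
    linarith

end Gap

/-- Nerve lemma: a space over a contractible simplicial complex `S` with barycentric
coordinates `μ`, all of whose open-star preimages are contractible, is contractible. -/
theorem nerve {n : ℕ} {X S : Type*} [TopologicalSpace X] [TopologicalSpace S]
    [ContractibleSpace S] (p : C(X, S)) (μ : S → Fin n → ℝ) (hμ : Continuous μ)
    (h0 : ∀ z i, 0 ≤ μ z i) (h1 : ∀ z, ∑ i, μ z i = 1)
    (hW : ∀ j : Finset (Fin n), j.Nonempty → (∃ z, ∀ i ∈ j, 0 < μ z i) →
      ContractibleSpace {x : X | ∀ i ∈ j, 0 < μ (p x) i}) : ContractibleSpace X := by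
  classical
  obtain ⟨z0⟩ : Nonempty S := inferInstance
  have hn : 0 < n := by
    rcases Nat.eq_zero_or_pos n with rfl | h
    · simpa using h1 z0
    · exact h
  have hn' : (0 : ℝ) < n := by exact_mod_cast hn
  set δ : ℝ := 1 / ((n : ℝ) * (n + 1)) / 2 with hδ
  have hδp : 0 < δ := by positivity
  let W : Finset (Fin n) → Set X := fun j => {x : X | ∀ i ∈ j, 0 < μ (p x) i}
  let g : Finset (Fin n) → S → ℝ := fun j z => gap j (μ z)
  have hpos : ∀ j z, δ ≤ g j z → ∀ i ∈ j, 0 < μ z i := fun j z h i hi =>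
    lt_of_lt_of_le hδp ((le_gap_iff (nonempty_of_gap hδp h) _ _).1 h i hi).1
  have hex : ∀ j, ∃ (D : X × ℝ → X) (b : X), ∀ z, δ ≤ g j z → (ContinuousOn D (W j ×ˢ univ) ∧
      (∀ x ∈ W j, ∀ t ≤ 0, D (x, t) = x) ∧
      (∀ x ∈ W j, ∀ t, 1 ≤ t → D (x, t) = b) ∧ (∀ x ∈ W j, ∀ t, D (x, t) ∈ W j)) := by
    intro j
    by_cases hj : ∃ z, δ ≤ g j z
    · obtain ⟨z, hz⟩ := hj
      have : ContractibleSpace (W j) := hW j (nonempty_of_gap hδp hz) ⟨z, hpos j z hz⟩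
      obtain ⟨D, b, h⟩ := exists_contraction (W j)
      exact ⟨D, b, fun _ _ => h⟩
    · obtain ⟨j1, hj1, hg1⟩ := exists_gap (μ z0) (h0 z0) (h1 z0)
      have hg2 : δ ≤ g j1 z0 := by
        refine le_trans ?_ hg1
        rw [hδ]; exact half_le_self (by positivity)
      have : ContractibleSpace (W j1) := hW j1 hj1 ⟨z0, hpos j1 z0 hg2⟩
      obtain ⟨x⟩ : Nonempty (W j1) := inferInstance
      exact ⟨fun q => q.1, x, fun z hz => absurd ⟨z, hz⟩ hj⟩
  choose D b hD using hex
  have hN : NData W g D b δ :=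
    { pos := hδp
      cg := fun j => (gap_continuous j).comp hμ
      cD := fun j z h => (hD j z h).1
      zero := fun j z h => (hD j z h).2.1
      one := fun j z h => (hD j z h).2.2.1
      mem := fun j z h => (hD j z h).2.2.2 }
  let l : List (Finset (Fin n)) :=
    (Finset.univ : Finset (Finset (Fin n))).toList.mergeSort fun a c => decide (c.card ≤ a.card)
  have hl : l.Pairwise fun a c => c.card ≤ a.card := by
    have := List.pairwise_mergeSort (le := fun a c : Finset (Fin n) => decide (c.card ≤ a.card))
      (by intro a b c; simp; omega) (by intro a b; simp; omega)
      (Finset.univ : Finset (Finset (Fin n))).toList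
    exact this.imp (by intro a c h; simpa using h)
  have hmem : ∀ j, j ∈ l := by intro j; simp [l]
  refine contractible_of_ndata hN l ?_ ?_ p ?_ ?_
  · refine hl.imp ?_
    intro a c hac z ha hc x hx i hi
    exact hx i (gap_subset hδp ha hc hac hi)
  · intro z
    obtain ⟨j, -, hj⟩ := exists_gap (μ z) (h0 z) (h1 z)
    refine ⟨j, hmem j, ?_⟩
    rw [hδ]
    linarith
  · intro x j _ hj
    exact hpos j _ hj
  · intro z
    let J : Finset (Fin n) := Finset.univ.filter fun i => 0 < μ z i
    have hJ : J.Nonempty := by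
      by_contra hcon
      rw [Finset.not_nonempty_iff_eq_empty, Finset.filter_eq_empty_iff] at hcon
      have : ∑ i, μ z i ≤ 0 := Finset.sum_nonpos fun i hi => not_lt.1 (hcon hi)
      rw [h1 z] at this
      linarith
    have := hW J hJ ⟨z, fun i hi => (Finset.mem_filter.1 hi).2⟩
    obtain ⟨x, hx⟩ : Nonempty {x : X | ∀ i ∈ J, 0 < μ (p x) i} := inferInstance
    refine ⟨x, fun j _ hj i hi => hx i ?_⟩
    exact Finset.mem_filter.2 ⟨Finset.mem_univ _, hpos j z hj i hi⟩

/-! ### Pointwise facts -/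

section Pointwise

/-- Carrier property of a cubical complex. -/
def CL {n : ℕ} (K : Set (Fin n → ℝ)) : Prop :=
  ∀ x ∈ K, ∀ y : Fin n → ℝ,
    (∀ i (m : ℤ), ((m : ℝ) ≤ x i → (m : ℝ) ≤ y i) ∧ (x i ≤ m → y i ≤ m)) → y ∈ K

theorem IsComplex.cl {n : ℕ} {K : Set (Fin n → ℝ)} (hK : IsComplex K) : CL K := by
  obtain ⟨C, -, rfl⟩ := hK
  intro x hx y hy
  simp only [mem_iUnion] at hx ⊢
  obtain ⟨c, hc, hx⟩ := hx
  refine ⟨c, hc, ?_, ?_⟩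
  · intro i
    exact (hy i ((c.1 - c.2) i)).1 (hx.1 i)
  · intro i
    exact (hy i (c.1 i)).2 (hx.2 i)

variable {n : ℕ} {K : Set (Fin n → ℝ)} {k : Fin n → ℤ} {q : Fin n → ℝ}

theorem near_mem (hK : CL K) (hq : q ∈ K) (hq1 : ∀ i, (k i : ℝ) - 1 < q i)
    (x : Fin n → ℝ)
    (hx : ∀ i, (k i : ℝ) - 1 ≤ x i ∧ x i ≤ k i ∧ (k i ≤ q i → x i = k i))
    (hq2 : ∀ i, q i ≤ k i) : x ∈ K := by
  refine hK q hq x fun i m => ⟨fun hm => ?_, fun hm => ?_⟩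
  · obtain ⟨h1, h2, h3⟩ := hx i
    rcases (hq2 i).lt_or_eq with h | h
    · have : (m : ℝ) < k i := lt_of_le_of_lt hm h
      have : m < k i := by exact_mod_cast this
      have : m ≤ k i - 1 := by omega
      have : (m : ℝ) ≤ k i - 1 := by exact_mod_cast this
      linarith
    · rw [h3 h.ge]; linarith
  · obtain ⟨h1, h2, h3⟩ := hx i
    have : (k i : ℝ) - 1 < m := lt_of_lt_of_le (hq1 i) hm
    have : k i - 1 < m := by exact_mod_cast this
    have : k i ≤ m := by omega
    have : (k i : ℝ) ≤ m := by exact_mod_cast this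
    linarith

/-- The pointwise formula for the main deformation. -/
noncomputable def Apt (k : Fin n → ℤ) (χ : Fin n → ℝ) (q y : Fin n → ℝ) (r a b : ℝ) : Fin n → ℝ :=
  fun i => min (min (y i) (q i)) (k i - r * χ i) +
    a * (k i - r * χ i - min (q i) (k i - r * χ i)) + b * (r * χ i)

theorem Apt_mem (hK : CL K) (hq : q ∈ K) (hq1 : ∀ i, (k i : ℝ) - 1 < q i)
    (hq2 : ∀ i, q i ≤ k i) {χ y : Fin n → ℝ} (hχ : ∀ i, χ i = 0 ∨ (χ i = 1 ∧ q i < k i))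
    (hy : y ∈ K) (hyq : y ≤ q ∨ q ≤ y) {r a b : ℝ} (hr : r ∈ Icc (0 : ℝ) 1)
    (ha : a ∈ Icc (0 : ℝ) 1) (hb : b ∈ Icc (0 : ℝ) 1) (hay : a = 0 ∨ q ≤ y)
    (hab : b = 0 ∨ a = 1) : Apt k χ q y r a b ∈ K := by
  by_cases hqy : q ≤ y
  · refine near_mem hK hq hq1 _ (fun i => ?_) hq2
    have h1 := hq1 i
    have h2 := hq2 i
    have h3 := hqy i
    unfold Apt
    rw [min_eq_right h3]
    rcases hχ i with h | ⟨h, h'⟩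
    · rw [h]
      simp only [mul_zero, sub_zero, add_zero]
      rw [min_eq_left h2]
      refine ⟨?_, ?_, ?_⟩
      · nlinarith [ha.1]
      · nlinarith [ha.2]
      · intro hh
        have : q i = k i := le_antisymm h2 hh
        rw [this]; ring
    · rw [h]
      simp only [mul_one]
      have e1 : min (q i) (k i - r) ≤ k i - r := min_le_right _ _
      have e2 : (k i : ℝ) - 1 ≤ min (q i) (k i - r) := le_min h1.le (by linarith [hr.2])
      refine ⟨?_, ?_, fun hh => absurd hh (not_le.2 h')⟩
      · nlinarith [ha.1, hb.1, hr.1, mul_nonneg ha.1 (sub_nonneg.2 e1), mul_nonneg hb.1 hr.1]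
      · nlinarith [mul_nonneg (sub_nonneg.2 ha.2) (sub_nonneg.2 e1),
          mul_nonneg (sub_nonneg.2 hb.2) hr.1]
  · have ha0 : a = 0 := hay.resolve_right hqy
    have hb0 : b = 0 := hab.resolve_right (by rw [ha0]; norm_num)
    have hyq' : y ≤ q := hyq.resolve_right hqy
    refine hK y hy _ fun i m => ?_
    have h3 := hyq' i
    unfold Apt
    rw [min_eq_left h3, ha0, hb0]
    simp only [zero_mul, add_zero]
    refine ⟨fun hm => le_min hm ?_, fun hm => (min_le_left _ _).trans hm⟩
    rcases hχ i with h | ⟨h, h'⟩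
    · rw [h, mul_zero, sub_zero]; linarith [hq2 i]
    · rw [h, mul_one]
      have : (m : ℝ) < k i := by linarith
      have : m < k i := by exact_mod_cast this
      have : m ≤ k i - 1 := by omega
      have : (m : ℝ) ≤ k i - 1 := by exact_mod_cast this
      linarith [hr.2]

theorem Apt_lt (hq2 : ∀ i, q i ≤ k i) {χ y : Fin n → ℝ}
    (hχ : ∀ i, χ i = 0 ∨ (χ i = 1 ∧ q i < k i))
    {r a b : ℝ} (hr : r ∈ Icc (0 : ℝ) 1)
    (ha : a ∈ Icc (0 : ℝ) 1) (hb : b ∈ Icc (0 : ℝ) 1) (hay : a = 0 ∨ q ≤ y)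
    (hab : b = 0 ∨ a = 1) (hs : ∑ i, ((k i : ℝ) - Apt k χ q y r a b i) = 1 / 2) {i : Fin n}
    (hi : χ i = 1) : Apt k χ q y r a b i < k i := by
  have hqi : q i < k i := by
    rcases hχ i with h | h
    · rw [h] at hi; norm_num at hi
    · exact h.2
  by_cases ha1 : a = 1
  · have hqy : q ≤ y := hay.resolve_left (by rw [ha1]; norm_num)
    have he : ∀ i, Apt k χ q y r a b i = k i - (1 - b) * r * χ i := by
      intro i
      unfold Apt
      rw [min_eq_right (hqy i), ha1]; ring
    rw [he i, hi]
    have hnn : 0 ≤ (1 - b) * r := mul_nonneg (sub_nonneg.2 hb.2) hr.1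
    rcases hnn.lt_or_eq with h | h
    · linarith
    · simp only [he, ← h] at hs
      simp at hs
  · have hb0 : b = 0 := hab.resolve_right ha1
    have ha2 : a < 1 := lt_of_le_of_ne ha.2 ha1
    unfold Apt
    rw [hb0, hi]
    simp only [mul_one, zero_mul, add_zero]
    have e1 : min (min (y i) (q i)) (k i - r) ≤ min (q i) (k i - r) :=
      min_le_min_right _ (min_le_right _ _)
    have e2 : min (q i) (k i - r) ≤ q i := min_le_left _ _
    have e3 := hr.1
    have e4 := ha.1
    nlinarith [mul_pos (sub_pos.2 ha2) (sub_pos.2 (lt_of_le_of_lt e2 hqi)), mul_nonneg e4 e3]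

theorem Apt_mono {χ : Fin n → ℝ} (hχ : ∀ i, 0 ≤ χ i) {y y' : Fin n → ℝ} {r a a' b b' : ℝ}
    (hr : 0 ≤ r) (hy : y ≤ y') (ha : a ≤ a') (hb : b ≤ b') :
    Apt k χ q y r a b ≤ Apt k χ q y' r a' b' := by
  intro i
  unfold Apt
  have h1 : 0 ≤ k i - r * χ i - min (q i) (k i - r * χ i) := sub_nonneg.2 (min_le_right _ _)
  have h2 : 0 ≤ r * χ i := mul_nonneg hr (hχ i)
  have h3 := hy i
  gcongr

/-- Comparable points of equal height agree. -/
theorem eq_of_le_of_sum {x y : Fin n → ℝ} (h : x ≤ y)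
    (hs : ∑ i, ((k i : ℝ) - x i) = ∑ i, ((k i : ℝ) - y i)) : x = y := by
  have := (Finset.sum_eq_sum_iff_of_le (s := Finset.univ) (f := fun i => (k i : ℝ) - y i)
    (g := fun i => (k i : ℝ) - x i) (fun i _ => by linarith [h i])).1 hs.symm
  ext i
  have := this i (Finset.mem_univ _)
  linarith

end Pointwise

/-! ### Dipath spaces -/

section Dipaths

open ContinuousMap unitInterval

variable {n : ℕ} {K : Set (Fin n → ℝ)}

/-- Projection to the unit interval. -/
noncomputable def pr (x : ℝ) : I := projIcc 0 1 zero_le_one x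

@[fun_prop]
theorem pr_continuous : Continuous pr := continuous_projIcc (h := zero_le_one)

theorem pr_mono : Monotone pr := monotone_projIcc zero_le_one

theorem pr_of_le {x : ℝ} (h : x ≤ 0) : pr x = 0 := projIcc_of_le_left _ h

theorem pr_of_ge {x : ℝ} (h : 1 ≤ x) : pr x = 1 := projIcc_of_right_le _ h

theorem pr_of_mem {x : ℝ} (h : 0 ≤ x) (h' : x ≤ 1) : (pr x : ℝ) = x := by
  have := projIcc_of_mem (zero_le_one (α := ℝ)) (x := x) ⟨h, h'⟩
  exact congrArg Subtype.val this

theorem pr_coe (t : I) : pr t = t := projIcc_val _ t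

theorem mk_map {p q : Fin n → ℝ} {Z : Type*} [TopologicalSpace Z] (Φ : Z → I → Fin n → ℝ)
    (hc : Continuous fun a : Z × I => Φ a.1 a.2)
    (h : ∀ z, (∀ t, Φ z t ∈ K) ∧ Φ z 0 = p ∧ Φ z 1 = q ∧ Monotone (Φ z)) :
    ∃ F : C(Z, ↥(DipathSpace K p q)), ∀ z t, (F z).1 t = Φ z t :=
  ⟨⟨fun z => ⟨⟨Φ z, hc.comp (Continuous.prodMk_right z)⟩, h z⟩,
    Continuous.subtype_mk (ContinuousMap.curry ⟨_, hc⟩).continuous _⟩, fun _ _ => rfl⟩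

theorem exists_cross {w k : Fin n → ℤ} (hwk : w ≤ k) (hne : w ≠ k) :
    ∃ q : ↥(DipathSpace K (toR w) (toR k)) → Fin n → ℝ, Continuous q ∧
      (∀ γ, ∃ t, γ.1 t = q γ) ∧ (∀ γ, ∑ i, ((k i : ℝ) - q γ i) = 1 / 2) ∧
      (∀ γ t, ∑ i, ((k i : ℝ) - γ.1 t i) = 1 / 2 → γ.1 t = q γ) := by
  have hsum : (1 : ℝ) ≤ ∑ i, ((k i : ℝ) - w i) := by
    have h1 : ∃ i, w i < k i := by
      by_contra! h
      exact hne (le_antisymm hwk h)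
    obtain ⟨i, hi⟩ := h1
    have h2 : ∑ i, (k i - w i) ≥ k i - w i :=
      Finset.single_le_sum (f := fun i => k i - w i) (fun i _ => sub_nonneg.2 (hwk i))
        (Finset.mem_univ i)
    have h3 : 1 ≤ ∑ i, (k i - w i) := by omega
    exact_mod_cast h3
  have hex : ∀ γ : ↥(DipathSpace K (toR w) (toR k)), ∃ t, ∑ i, ((k i : ℝ) - γ.1 t i) = 1 / 2 := by
    rintro ⟨γ, hγ, h0, h1, hm⟩
    have hc : Continuous fun t : I => ∑ i, ((k i : ℝ) - γ t i) := by
      refine continuous_finsetSum _ fun i _ => continuous_const.sub ?_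
      exact (continuous_apply i).comp γ.continuous
    have := mem_range_of_exists_le_of_exists_ge hc (c := 1 / 2) ⟨1, by simp [h1, toR]⟩
      ⟨0, by simp only [h0, toR]; linarith⟩
    exact this
  choose T hT using hex
  have huniq : ∀ (γ : ↥(DipathSpace K (toR w) (toR k))) t,
      ∑ i, ((k i : ℝ) - γ.1 t i) = 1 / 2 → γ.1 t = γ.1 (T γ) := by
    intro γ t ht
    rcases le_total t (T γ) with h | h
    · exact eq_of_le_of_sum (γ.2.2.2.2 h) (ht.trans (hT γ).symm)
    · exact (eq_of_le_of_sum (γ.2.2.2.2 h) ((hT γ).trans ht.symm)).symm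
  refine ⟨fun γ => γ.1 (T γ), ?_, fun γ => ⟨_, rfl⟩, hT, huniq⟩
  -- an asymmetric Lipschitz estimate
  have key : ∀ γ₁ γ₂ : ↥(DipathSpace K (toR w) (toR k)),
      dist (γ₁.1 (T γ₁)) (γ₂.1 (T γ₂)) ≤ ((n : ℝ) + 1) * dist γ₁.1 γ₂.1 := by
    intro γ₁ γ₂
    set ε := dist γ₁.1 γ₂.1 with hε
    have hε0 : 0 ≤ ε := dist_nonneg
    have hp : ∀ t i, |γ₁.1 t i - γ₂.1 t i| ≤ ε := by
      intro t i
      rw [← Real.dist_eq]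
      exact (dist_le_pi_dist _ _ i).trans (ContinuousMap.dist_apply_le_dist t)
    have hs1 := hT γ₁
    have hs2 := hT γ₂
    have hsum1 : |∑ i, (γ₁.1 (T γ₁) i - γ₂.1 (T γ₁) i)| ≤ n * ε := by
      refine (Finset.abs_sum_le_sum_abs _ _).trans ?_
      refine (Finset.sum_le_sum fun i _ => hp (T γ₁) i).trans ?_
      simp
    have hd : ∑ i, (γ₁.1 (T γ₁) i - γ₂.1 (T γ₁) i)
        = ∑ i, (γ₂.1 (T γ₂) i - γ₂.1 (T γ₁) i) := by
      simp only [Finset.sum_sub_distrib] at hs1 hs2 ⊢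
      linarith
    have hbd : ∀ i, |γ₂.1 (T γ₂) i - γ₂.1 (T γ₁) i| ≤ n * ε := by
      intro i
      rw [hd] at hsum1
      rcases le_total (T γ₁) (T γ₂) with h | h
      · have hle : ∀ i, 0 ≤ γ₂.1 (T γ₂) i - γ₂.1 (T γ₁) i :=
          fun i => sub_nonneg.2 (γ₂.2.2.2.2 h i)
        rw [abs_of_nonneg (hle i)]
        exact (Finset.single_le_sum (fun i _ => hle i) (Finset.mem_univ i)).trans
          ((le_abs_self _).trans hsum1)
      · have hle : ∀ i, 0 ≤ γ₂.1 (T γ₁) i - γ₂.1 (T γ₂) i :=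
          fun i => sub_nonneg.2 (γ₂.2.2.2.2 h i)
        rw [abs_sub_comm, abs_of_nonneg (hle i)]
        refine (Finset.single_le_sum (fun i _ => hle i) (Finset.mem_univ i)).trans ?_
        refine le_trans (le_of_eq ?_) ((neg_le_abs _).trans hsum1)
        rw [← Finset.sum_neg_distrib]
        simp
    refine (dist_pi_le_iff (by positivity)).2 fun i => ?_
    rw [Real.dist_eq]
    have e1 := hp (T γ₁) i
    have e2 := hbd i
    rw [abs_le] at e1 e2 ⊢
    constructor <;> nlinarith
  refine LipschitzWith.continuous (K := ⟨(n : ℝ) + 1, by positivity⟩)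
    (LipschitzWith.of_dist_le_mul fun γ₁ γ₂ => ?_)
  exact key γ₁ γ₂

/-- The main local step: preimages of open stars are contractible. -/
theorem star_contractible (hK : CL K) {w k k' : Fin n → ℤ} (hwk' : w ≤ k')
    (j : Finset (Fin n)) (hk' : ∀ i, k' i = k i - if i ∈ j then 1 else 0)
    (hcube : Icc (toR k') (toR k) ⊆ K)
    (q : ↥(DipathSpace K (toR w) (toR k)) → Fin n → ℝ) (hqc : Continuous q)
    (hqt : ∀ γ, ∃ t, γ.1 t = q γ) (hqs : ∀ γ, ∑ i, ((k i : ℝ) - q γ i) = 1 / 2)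
    (hqu : ∀ γ t, ∑ i, ((k i : ℝ) - γ.1 t i) = 1 / 2 → γ.1 t = q γ)
    [ContractibleSpace ↥(DipathSpace K (toR w) (toR k'))] :
    ContractibleSpace {γ : ↥(DipathSpace K (toR w) (toR k)) | ∀ i ∈ j, q γ i < k i} := by
  classical
  set W := {γ : ↥(DipathSpace K (toR w) (toR k)) | ∀ i ∈ j, q γ i < k i} with hW
  let χ : Fin n → ℝ := fun i => if i ∈ j then 1 else 0
  have hχ0 : ∀ i, 0 ≤ χ i := fun i => by simp only [χ]; split_ifs <;> norm_num
  have hχ1 : ∀ i, χ i ≤ 1 := fun i => by simp only [χ]; split_ifs <;> norm_num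
  have hχj : ∀ i, i ∈ j → χ i = 1 := fun i hi => by simp [χ, hi]
  have hk'χ : ∀ i, (k' i : ℝ) = k i - χ i := fun i => by
    rw [hk' i]; simp only [χ]; split_ifs <;> simp
  have hwk : ∀ i, (w i : ℝ) ≤ k i - χ i := fun i => by
    rw [← hk'χ]; exact_mod_cast hwk' i
  have hle : ∀ (γ : ↥(DipathSpace K (toR w) (toR k))) t i, γ.1 t i ≤ k i := by
    intro γ t i
    have := γ.2.2.2.2 (unitInterval.le_one' : t ≤ 1) i
    rw [γ.2.2.2.1] at this
    exact this
  have hge : ∀ (γ : ↥(DipathSpace K (toR w) (toR k))) t i, (w i : ℝ) ≤ γ.1 t i := by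
    intro γ t i
    have := γ.2.2.2.2 (unitInterval.nonneg' : 0 ≤ t) i
    rw [γ.2.2.1] at this
    exact this
  have hqK : ∀ γ, q γ ∈ K := fun γ => by
    obtain ⟨t, ht⟩ := hqt γ
    rw [← ht]; exact γ.2.1 t
  have hq2 : ∀ γ i, q γ i ≤ k i := fun γ i => by
    obtain ⟨t, ht⟩ := hqt γ
    rw [← ht]; exact hle γ t i
  have hqw : ∀ γ i, (w i : ℝ) ≤ q γ i := fun γ i => by
    obtain ⟨t, ht⟩ := hqt γ
    rw [← ht]; exact hge γ t i
  have hq1 : ∀ γ i, (k i : ℝ) - 1 < q γ i := fun γ i => by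
    have := Finset.single_le_sum (f := fun i => (k i : ℝ) - q γ i)
      (fun i _ => sub_nonneg.2 (hq2 γ i)) (Finset.mem_univ i)
    rw [hqs γ] at this
    linarith
  have hcomp : ∀ γ t, γ.1 t ≤ q γ ∨ q γ ≤ γ.1 t := fun γ t => by
    obtain ⟨t', ht'⟩ := hqt γ
    rw [← ht']
    exact (le_total t t').imp (fun h => γ.2.2.2.2 h) fun h => γ.2.2.2.2 h
  have hχW : ∀ γ : W, ∀ i, χ i = 0 ∨ (χ i = 1 ∧ q γ.1 i < k i) := by
    rintro ⟨γ, hγ⟩ i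
    by_cases hi : i ∈ j
    · exact Or.inr ⟨hχj i hi, hγ i hi⟩
    · left; simp [χ, hi]
  -- building maps to `W`
  have mkW : ∀ {Z : Type} [TopologicalSpace Z] (Φ : Z → I → Fin n → ℝ)
      (_ : Continuous fun a : Z × I => Φ a.1 a.2)
      (_ : ∀ z, (∀ t, Φ z t ∈ K) ∧ Φ z 0 = toR w ∧ Φ z 1 = toR k ∧ Monotone (Φ z))
      (_ : ∀ z t, ∑ i, ((k i : ℝ) - Φ z t i) = 1 / 2 → ∀ i ∈ j, Φ z t i < k i),
      ∃ F : C(Z, W), ∀ z t, (F z).1.1 t = Φ z t := by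
    intro Z _ Φ hc h h'
    obtain ⟨F, hF⟩ := mk_map Φ hc h
    suffices hmem : ∀ z, F z ∈ W from
      ⟨⟨fun z => ⟨F z, hmem z⟩, F.continuous.subtype_mk hmem⟩, hF⟩
    intro z i hi
    obtain ⟨t, ht⟩ := hqt (F z)
    have h1 := hqs (F z)
    rw [← ht, hF] at h1 ⊢
    exact h' z t h1 i hi
  have mkH : ∀ (f g : C(W, W)) (Φ : I × W → I → Fin n → ℝ)
      (_ : Continuous fun a : (I × W) × I => Φ a.1 a.2)
      (_ : ∀ z, (∀ t, Φ z t ∈ K) ∧ Φ z 0 = toR w ∧ Φ z 1 = toR k ∧ Monotone (Φ z))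
      (_ : ∀ z t, ∑ i, ((k i : ℝ) - Φ z t i) = 1 / 2 → ∀ i ∈ j, Φ z t i < k i)
      (_ : ∀ γ t, Φ (0, γ) t = (f γ).1.1 t) (_ : ∀ γ t, Φ (1, γ) t = (g γ).1.1 t),
      Homotopic f g := by
    intro f g Φ hc h h' h0 h1
    obtain ⟨F, hF⟩ := mkW Φ hc h h'
    refine ⟨⟨F, fun γ => ?_, fun γ => ?_⟩⟩
    · refine Subtype.ext (Subtype.ext (ContinuousMap.ext fun t => ?_))
      exact (hF (0, γ) t).trans (h0 γ t)
    · refine Subtype.ext (Subtype.ext (ContinuousMap.ext fun t => ?_))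
      exact (hF (1, γ) t).trans (h1 γ t)
  -- the main deformation
  let A : I × W → I → Fin n → ℝ := fun z t =>
    Apt k χ (q z.2.1) (z.2.1.1 (pr (3 * t))) z.1 (pr (3 * t - 1)) (pr (3 * t - 2))
  have hqW : Continuous fun γ : W => q γ.1 := hqc.comp continuous_subtype_val
  have hev : Continuous fun a : W × I => a.1.1.1 a.2 := by
    have h1 : Continuous fun a : W × I => a.1.1.1 :=
      (continuous_subtype_val.comp continuous_subtype_val).comp continuous_fst
    exact h1.eval continuous_snd
  have hevi : ∀ i, Continuous fun a : W × I => a.1.1.1 a.2 i := fun i =>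
    (continuous_apply i).comp hev
  have hqWi : ∀ i, Continuous fun γ : W => q γ.1 i := fun i =>
    (continuous_apply i).comp hqW
  have hAc : Continuous fun a : (I × W) × I => A a.1 a.2 := by
    refine continuous_pi fun i => ?_
    simp only [A, Apt]
    have c1 : Continuous fun a : (I × W) × I => a.1.2.1.1 (pr (3 * (a.2 : ℝ))) i :=
      (hevi i).comp (Continuous.prodMk (by fun_prop) (by fun_prop))
    have c2 : Continuous fun a : (I × W) × I => q a.1.2.1 i :=
      (hqWi i).comp (by fun_prop)
    fun_prop
  have hAab : ∀ t : I, ((pr (3 * t - 2) : I) : ℝ) = 0 ∨ ((pr (3 * t - 1) : I) : ℝ) = 1 := by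
    intro t
    rcases le_total (3 * (t : ℝ) - 2) 0 with h | h
    · left; rw [pr_of_le h]; rfl
    · right; rw [pr_of_ge (by linarith)]; rfl
  have hAay : ∀ (z : I × W) (t : I), ((pr (3 * t - 1) : I) : ℝ) = 0 ∨
      q z.2.1 ≤ z.2.1.1 (pr (3 * t)) := by
    intro z t
    rcases le_total (3 * (t : ℝ) - 1) 0 with h | h
    · left; rw [pr_of_le h]; rfl
    · right; rw [pr_of_ge (by linarith), z.2.1.2.2.2.1]
      exact fun i => hq2 _ i
  have hAK : ∀ z t, A z t ∈ K := fun z t =>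
    Apt_mem hK (hqK _) (hq1 _) (hq2 _) (hχW z.2) (z.2.1.2.1 _) (hcomp _ _) z.1.2
      (Subtype.prop _) (Subtype.prop _) (hAay z t) (hAab t)
  have hAm : ∀ z, Monotone (A z) := by
    intro z t t' h
    have h' : (t : ℝ) ≤ t' := h
    refine Apt_mono hχ0 z.1.2.1 (z.2.1.2.2.2.2 (pr_mono (by linarith))) ?_ ?_
    · exact pr_mono (by linarith)
    · exact pr_mono (by linarith)
  have hrχ : ∀ (r : I) i, (r : ℝ) * χ i ≤ χ i := fun r i => by
    nlinarith [hχ0 i, r.2.1, r.2.2]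
  have hA0 : ∀ z, A z 0 = toR w := by
    intro z
    ext i
    simp only [A, Apt]
    rw [pr_of_le (x := 3 * ((0 : I) : ℝ)) (by simp), pr_of_le (x := 3 * ((0 : I) : ℝ) - 1) (by simp),
      pr_of_le (x := 3 * ((0 : I) : ℝ) - 2) (by simp), z.2.1.2.2.1]
    simp only [toR, Set.Icc.coe_zero, zero_mul, add_zero]
    rw [min_eq_left (hqw _ i), min_eq_left (by linarith [hwk i, hrχ z.1 i])]
  have hA23 : ∀ z (t : I), 2 ≤ 3 * (t : ℝ) →
      A z t = fun i => (k i : ℝ) - (z.1 : ℝ) * χ i + (pr (3 * t - 2) : ℝ) * ((z.1 : ℝ) * χ i) := by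
    intro z t ht
    ext i
    simp only [A, Apt]
    rw [pr_of_ge (x := 3 * (t : ℝ)) (by linarith), pr_of_ge (x := 3 * (t : ℝ) - 1) (by linarith),
      z.2.1.2.2.2.1]
    simp only [toR, Set.Icc.coe_one, one_mul]
    rw [min_eq_right (hq2 _ i)]
    ring
  have hA1 : ∀ z, A z 1 = toR k := by
    intro z
    rw [hA23 z 1 (by norm_num)]
    ext i
    rw [pr_of_ge (x := 3 * ((1 : I) : ℝ) - 2) (by norm_num)]
    simp [toR]
  have hAlt : ∀ z t, ∑ i, ((k i : ℝ) - A z t i) = 1 / 2 → ∀ i ∈ j, A z t i < k i :=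
    fun z t hs i hi => Apt_lt (hq2 _) (hχW z.2) z.1.2 (Subtype.prop _) (Subtype.prop _)
      (hAay z t) (hAab t) hs (hχj i hi)
  -- the maps at time zero and one
  have hmk : ∀ r : I, ∃ F : C(W, W), ∀ γ t, (F γ).1.1 t = A (r, γ) t := fun r =>
    mkW (fun γ t => A (r, γ) t) (hAc.comp (f := fun a : W × I => ((r, a.1), a.2)) (by fun_prop))
      (fun γ => ⟨hAK _, hA0 _, hA1 _, hAm _⟩) fun γ t => hAlt _ t
  obtain ⟨F0, hF0⟩ := hmk 0
  obtain ⟨F1, hF1⟩ := hmk 1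
  have H01 : Homotopic F0 F1 := mkH F0 F1 A hAc (fun z => ⟨hAK z, hA0 z, hA1 z, hAm z⟩) hAlt
    (fun γ t => (hF0 γ t).symm) (fun γ t => (hF1 γ t).symm)
  -- reparametrization
  obtain ⟨R, hR⟩ := mkW (fun (γ : W) t => γ.1.1 (pr (3 * t)))
    (hev.comp (f := fun a : W × I => (a.1, pr (3 * a.2))) (by fun_prop))
    (fun γ => ⟨fun t => γ.1.2.1 _, by
      rw [pr_of_le (by simp)]; exact γ.1.2.2.1, by
      rw [pr_of_ge (by norm_num)]; exact γ.1.2.2.2.1,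
      fun t t' h => γ.1.2.2.2.2 (pr_mono (by have : (t : ℝ) ≤ t' := h; linarith))⟩)
    (fun γ t hs i hi => by
      rw [hqu _ _ hs]; exact γ.2 i hi)
  have HR : Homotopic (ContinuousMap.id W) R := by
    refine mkH _ _ (fun z t => z.2.1.1 (pr ((1 + 2 * z.1) * t))) ?_ ?_ ?_ ?_ ?_
    · exact hev.comp (f := fun a : (I × W) × I => (a.1.2, pr ((1 + 2 * a.1.1) * a.2)))
        (by fun_prop)
    · intro z
      have hz := z.1.2.1
      refine ⟨fun t => z.2.1.2.1 _, ?_, ?_, ?_⟩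
      · rw [pr_of_le (by simp)]; exact z.2.1.2.2.1
      · rw [pr_of_ge (by simp; exact hz)]; exact z.2.1.2.2.2.1
      · intro t t' h
        have h' : (t : ℝ) ≤ t' := h
        exact z.2.1.2.2.2.2 (pr_mono (by gcongr))
    · intro z t hs i hi
      rw [hqu _ _ hs]; exact z.2.2 i hi
    · intro γ t
      simp [pr_coe]
    · intro γ t
      rw [hR]; norm_num
  -- interpolation
  have HB : Homotopic R F0 := by
    have hcase : ∀ (γ : W) (t : I),
        (A (0, γ) t = γ.1.1 (pr (3 * t)) ∧ γ.1.1 (pr (3 * t)) ≤ q γ.1) ∨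
        (q γ.1 ≤ A (0, γ) t ∧ q γ.1 ≤ γ.1.1 (pr (3 * t))) := by
      intro γ t
      by_cases hqy : q γ.1 ≤ γ.1.1 (pr (3 * t))
      · right
        refine ⟨fun i => ?_, hqy⟩
        simp only [A, Apt, Set.Icc.coe_zero, zero_mul, sub_zero, mul_zero, add_zero]
        rw [min_eq_right (hqy i), min_eq_left (hq2 _ i)]
        have := mul_nonneg (pr (3 * t - 1)).2.1 (sub_nonneg.2 (hq2 γ.1 i))
        linarith
      · left
        have ha := (hAay (0, γ) t).resolve_right hqy
        have hyq := (hcomp γ.1 (pr (3 * t))).resolve_right hqy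
        refine ⟨?_, hyq⟩
        ext i
        simp only [A, Apt, Set.Icc.coe_zero, zero_mul, sub_zero, mul_zero, add_zero]
        rw [ha, min_eq_left (hyq i), min_eq_left (hle _ _ i)]
        ring
    have hAle : ∀ (γ : W) t i, A (0, γ) t i ≤ k i := by
      intro γ t i
      have := hAm (0, γ) (unitInterval.le_one' : t ≤ 1) i
      rw [hA1] at this
      exact this
    refine mkH _ _ (fun z t i => (1 - z.1) * z.2.1.1 (pr (3 * t)) i + z.1 * A (0, z.2) t i)
      ?_ ?_ ?_ ?_ ?_
    · refine continuous_pi fun i => ?_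
      have c1 : Continuous fun a : (I × W) × I => a.1.2.1.1 (pr (3 * (a.2 : ℝ))) i :=
        (hevi i).comp (Continuous.prodMk (by fun_prop) (by fun_prop))
      have c2 : Continuous fun a : (I × W) × I => A (0, a.1.2) a.2 i :=
        ((continuous_apply i).comp hAc).comp
          (f := fun a : (I × W) × I => (((0 : I), a.1.2), a.2)) (by fun_prop)
      fun_prop
    · rintro ⟨s, γ⟩
      have hs0 : (0 : ℝ) ≤ s := s.2.1
      have hs1 : (0 : ℝ) ≤ 1 - s := sub_nonneg.2 s.2.2
      refine ⟨fun t => ?_, ?_, ?_, ?_⟩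
      · rcases hcase γ t with ⟨h1, h2⟩ | ⟨h1, h2⟩
        · dsimp only
          rw [h1]
          convert! γ.1.2.1 (pr (3 * t)) using 1
          ext i; ring
        · refine near_mem hK (hqK γ.1) (hq1 γ.1) _ (fun i => ?_) (hq2 γ.1)
          have e1 := h1 i
          have e2 := h2 i
          have e3 := hAle γ t i
          have e4 := hle γ.1 (pr (3 * t)) i
          have e5 := hq1 γ.1 i
          dsimp only
          refine ⟨by nlinarith, by nlinarith, fun hh => ?_⟩
          have e6 : A (0, γ) t i = k i := by linarith
          have e7 : γ.1.1 (pr (3 * t)) i = k i := by linarith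
          rw [e6, e7]; ring
      · ext i
        dsimp only
        rw [hA0, pr_of_le (by simp), γ.1.2.2.1]; ring
      · ext i
        dsimp only
        rw [hA1, pr_of_ge (by norm_num), γ.1.2.2.2.1]; ring
      · intro t t' h i
        have h' : (t : ℝ) ≤ t' := h
        have e1 := hAm (0, γ) h i
        have e2 := γ.1.2.2.2.2 (pr_mono (by linarith : 3 * (t : ℝ) ≤ 3 * t')) i
        dsimp only
        gcongr
    · rintro ⟨s, γ⟩ t hs i hi
      have hs0 : (0 : ℝ) ≤ s := s.2.1
      have hs1 : (0 : ℝ) ≤ 1 - s := sub_nonneg.2 s.2.2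
      have hqi := γ.2 i hi
      rcases hcase γ t with ⟨h1, h2⟩ | ⟨h1, h2⟩
      · dsimp only
        rw [h1]
        have := h2 i
        nlinarith
      · have := eq_of_le_of_sum (k := k) (x := q γ.1)
          (y := fun i => (1 - s) * γ.1.1 (pr (3 * t)) i + s * A (0, γ) t i)
          (fun i => by
            have e1 := h1 i
            have e2 := h2 i
            dsimp only
            nlinarith) ((hqs γ.1).trans hs.symm)
        dsimp only
        rw [← congrFun this i]
        exact hqi
    · intro γ t
      rw [hR]
      ext i
      simp
    · intro γ t
      rw [hF0]
      ext i
      simp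
  -- factorization of `F1` through the smaller dipath space
  have h23 : ∀ t : I, (pr (2 / 3 * (t : ℝ)) : ℝ) = 2 / 3 * t := fun t =>
    pr_of_mem (by linarith [t.2.1]) (by linarith [t.2.2])
  obtain ⟨ρ, hρ⟩ := mk_map (K := K) (p := toR w) (q := toR k')
    (fun (γ : W) t => A (1, γ) (pr (2 / 3 * t)))
    (hAc.comp (f := fun a : W × I => (((1 : I), a.1), pr (2 / 3 * a.2))) (by fun_prop))
    (fun γ => ⟨fun t => hAK _ _, by
      rw [pr_of_le (by simp)]; exact hA0 _, by
      rw [hA23 _ _ (by rw [h23]; norm_num), h23, pr_of_le (by norm_num)]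
      ext i
      simp [toR, hk'χ],
      fun t t' h => hAm _ (pr_mono (by have : (t : ℝ) ≤ t' := h; linarith))⟩)
  obtain ⟨e, he⟩ := mkW (fun (β : ↥(DipathSpace K (toR w) (toR k'))) t i =>
      β.1 (pr (3 / 2 * t)) i + pr (3 * t - 2) * χ i)
    (by
      refine continuous_pi fun i => ?_
      have h1 : Continuous fun a : ↥(DipathSpace K (toR w) (toR k')) × I =>
          a.1.1 (pr (3 / 2 * (a.2 : ℝ))) :=
        Continuous.eval (by fun_prop) (by fun_prop)
      have h2 := (continuous_apply i).comp h1
      simp only [Function.comp_def] at h2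
      fun_prop)
    (by
      intro β
      refine ⟨fun t => ?_, ?_, ?_, ?_⟩
      · rcases le_total (3 * (t : ℝ) - 2) 0 with h | h
        · rw [pr_of_le h]
          convert! β.2.1 (pr (3 / 2 * t)) using 1
          ext i; simp
        · rw [pr_of_ge (x := 3 / 2 * (t : ℝ)) (by linarith), β.2.2.2.1]
          have p0 := (pr (3 * (t : ℝ) - 2)).2.1
          have p1 := (pr (3 * (t : ℝ) - 2)).2.2
          refine hcube ⟨fun i => ?_, fun i => ?_⟩
          · have := mul_nonneg p0 (hχ0 i)
            linarith
          · simp only [toR, hk'χ]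
            nlinarith [hχ0 i]
      · ext i
        rw [pr_of_le (x := 3 / 2 * ((0 : I) : ℝ)) (by simp),
          pr_of_le (x := 3 * ((0 : I) : ℝ) - 2) (by simp), β.2.2.1]
        simp
      · ext i
        rw [pr_of_ge (x := 3 / 2 * ((1 : I) : ℝ)) (by norm_num),
          pr_of_ge (x := 3 * ((1 : I) : ℝ) - 2) (by norm_num), β.2.2.2.1]
        simp [toR, hk'χ]
      · intro t t' h i
        have h' : (t : ℝ) ≤ t' := h
        have e1 := β.2.2.2.2 (pr_mono (by linarith : 3 / 2 * (t : ℝ) ≤ 3 / 2 * t')) i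
        have e2 : (pr (3 * (t : ℝ) - 2) : ℝ) ≤ pr (3 * (t' : ℝ) - 2) := pr_mono (by linarith)
        have e3 := hχ0 i
        dsimp only
        gcongr)
    (by
      intro β t hs i hi
      rcases le_total (3 * (t : ℝ) - 2) 0 with h | h
      · rw [pr_of_le h]
        have := β.2.2.2.2 (unitInterval.le_one' : pr (3 / 2 * t) ≤ 1) i
        rw [β.2.2.2.1] at this
        simp only [toR, hk'χ, hχj i hi] at this
        simp
        linarith
      · rw [pr_of_ge (x := 3 / 2 * (t : ℝ)) (by linarith), β.2.2.2.1] at hs ⊢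
        simp only [toR, hk'χ] at hs ⊢
        rw [hχj i hi]
        have p1 := (pr (3 * (t : ℝ) - 2)).2.2
        rcases p1.lt_or_eq with h2 | h2
        · linarith
        · rw [h2] at hs
          simp at hs)
  have hfac : F1 = e.comp ρ := by
    refine ContinuousMap.ext fun γ => Subtype.ext (Subtype.ext (ContinuousMap.ext fun t => ?_))
    rw [hF1, ContinuousMap.comp_apply, he]
    rcases le_total (3 * (t : ℝ) - 2) 0 with h | h
    · have h3 : (pr (3 / 2 * (t : ℝ)) : ℝ) = 3 / 2 * t :=
        pr_of_mem (by linarith [t.2.1]) (by linarith)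
      have h4 : pr (2 / 3 * (pr (3 / 2 * (t : ℝ)) : ℝ)) = t := by
        rw [h3, ← mul_assoc]; norm_num [pr_coe]
      ext i
      rw [hρ, h4, pr_of_le h]
      simp
    · have h3 := pr_of_ge (x := 3 / 2 * (t : ℝ)) (by linarith)
      rw [h3, (ρ γ).2.2.2.1, hA23 _ _ (by linarith)]
      ext i
      simp [toR, hk'χ]
  have Hfin : Homotopic (ContinuousMap.id W) (e.comp ρ) := by
    rw [← hfac]
    exact (HR.trans HB).trans H01
  rw [contractible_iff_id_nullhomotopic]
  obtain ⟨y, hy⟩ :=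
    ((id_nullhomotopic ↥(DipathSpace K (toR w) (toR k'))).comp_right e).comp_left ρ
  exact ⟨y, Hfin.trans hy⟩

end Dipaths

/-! ### The realization of the past link and the conclusion -/

section Final

variable {n : ℕ} {K : Set (Fin n → ℝ)}

theorem geomReal_spec {k : Fin n → ℤ} {z : Fin n → ℝ} (hz : z ∈ geomReal K k) :
    (∀ i, z i ≤ k i) ∧ ∑ i, ((k i : ℝ) - z i) = 1 ∧
      ∃ J ∈ pastlk K k, ∀ i, z i < k i → J i = 1 := by
  classical
  unfold geomReal at hz
  simp only [mem_iUnion] at hz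
  obtain ⟨J, hJ, hz⟩ := hz
  let T : Set (Fin n → ℝ) :=
    {x | (∀ i, x i ≤ k i) ∧ ∑ i, ((k i : ℝ) - x i) = 1 ∧ ∀ i, J i ≠ 1 → x i = k i}
  have hT : Convex ℝ T := by
    intro x hx y hy a b ha hb hab
    refine ⟨fun i => ?_, ?_, fun i hi => ?_⟩
    · have := hx.1 i
      have := hy.1 i
      simp only [Pi.add_apply, Pi.smul_apply, smul_eq_mul]
      have e : (k i : ℝ) = a * k i + b * k i := by rw [← add_mul, hab, one_mul]
      rw [e]; gcongr
    · have e : ∀ i, (k i : ℝ) - (a • x + b • y) i = a * (k i - x i) + b * (k i - y i) := by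
        intro i
        simp only [Pi.add_apply, Pi.smul_apply, smul_eq_mul]
        have e : (k i : ℝ) = a * k i + b * k i := by rw [← add_mul, hab, one_mul]
        linarith
      simp only [e, Finset.sum_add_distrib, ← Finset.mul_sum]
      rw [hx.2.1, hy.2.1]; linarith
    · simp only [Pi.add_apply, Pi.smul_apply, smul_eq_mul]
      rw [hx.2.2 i hi, hy.2.2 i hi, ← add_mul, hab, one_mul]
  have hsub : convexHull ℝ ((fun i => toR k - Pi.single i (1 : ℝ)) '' {i | J i = 1}) ⊆ T := by
    refine convexHull_min ?_ hT
    rintro _ ⟨l, hl, rfl⟩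
    refine ⟨fun i => ?_, ?_, fun i hi => ?_⟩
    · by_cases h : i = l
      · subst h; simp [toR]
      · simp [toR, h]
    · simp [toR, Pi.single_apply]
    · have : i ≠ l := fun h => hi (h ▸ hl)
      simp [toR, this]
  obtain ⟨h1, h2, h3⟩ := hsub hz
  refine ⟨h1, h2, J, hJ, fun i hi => ?_⟩
  by_contra hne
  exact hi.ne (h3 i hne)

theorem mem_geomReal (hK : CL K) {k : Fin n → ℤ} {q : Fin n → ℝ} (hq : q ∈ K)
    (hle : ∀ i, q i ≤ k i) (hs : ∑ i, ((k i : ℝ) - q i) = 1 / 2) :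
    (fun i => 2 * q i - k i) ∈ geomReal K k := by
  classical
  have hq1 : ∀ i, (k i : ℝ) - 1 < q i := by
    intro i
    have := Finset.single_le_sum (f := fun i => (k i : ℝ) - q i)
      (fun i _ => sub_nonneg.2 (hle i)) (Finset.mem_univ i)
    rw [hs] at this
    linarith
  let J : Fin n → ℤ := fun i => if q i < k i then 1 else 0
  have hJ : J ∈ pastlk K k := by
    refine ⟨fun i => ?_, fun h => ?_, fun x hx => ?_⟩
    · by_cases h : q i < k i
      · right; simp [J, h]
      · left; simp [J, h]
    · have : ∀ i, (k i : ℝ) - q i = 0 := by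
        intro i
        have hi := congrFun h i
        by_cases h : q i < k i
        · simp [J, h] at hi
        · linarith [hle i]
      simp [this] at hs
    · refine near_mem hK hq hq1 x (fun i => ?_) hle
      have a1 := hx.1 i
      have a2 := hx.2 i
      simp only [toR, Pi.sub_apply] at a1 a2
      by_cases h : q i < k i
      · simp only [J, h, if_true] at a1
        push_cast at a1
        exact ⟨a1, a2, fun hh => absurd hh (not_le.2 h)⟩
      · simp only [J, h, if_false] at a1
        push_cast at a1
        exact ⟨by linarith, a2, fun _ => by linarith⟩
  unfold geomReal
  simp only [mem_iUnion]
  refine ⟨J, hJ, ?_⟩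
  have e : (fun i => 2 * q i - (k i : ℝ)) = ∑ l ∈ Finset.univ.filter (fun l => q l < k l),
      (2 * (k l - q l)) • (toR k - Pi.single l (1 : ℝ)) := by
    ext i
    have e0 : ∀ l ∉ Finset.univ.filter (fun l => q l < k l), (2 * ((k l : ℝ) - q l)) •
        (toR k - Pi.single l (1 : ℝ) : Fin n → ℝ) i = 0 := by
      intro l hl
      simp only [Finset.mem_filter, Finset.mem_univ, true_and, not_lt] at hl
      have : (k l : ℝ) - q l = 0 := by linarith [hle l]
      rw [this]; simp
    rw [Finset.sum_apply]
    simp only [Pi.smul_apply]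
    rw [Finset.sum_subset (Finset.subset_univ _) (fun l _ hl => e0 l hl)]
    simp only [Pi.sub_apply, smul_eq_mul, mul_sub, Finset.sum_sub_distrib]
    have e1 : ∑ l, 2 * (k l : ℝ) * toR k i - ∑ l, 2 * q l * toR k i = toR k i := by
      rw [← Finset.sum_sub_distrib]
      have : ∀ l, 2 * (k l : ℝ) * toR k i - 2 * q l * toR k i = (k l - q l) * (2 * toR k i) := by
        intro l; ring
      simp only [this, ← Finset.sum_mul]
      rw [hs]; ring
    simp only [sub_mul, Finset.sum_sub_distrib]
    rw [e1]
    simp only [Pi.single_apply, mul_ite, mul_one, mul_zero, Finset.sum_ite_eq,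
      Finset.mem_univ, if_true, toR]
    ring
  rw [e]
  refine (convex_convexHull ℝ _).sum_mem (fun l _ => ?_) ?_ (fun l hl => ?_)
  · have := hle l
    linarith
  · rw [← Finset.mul_sum, Finset.sum_subset (Finset.subset_univ _), hs]
    · norm_num
    · intro l _ hl
      simp only [Finset.mem_filter, Finset.mem_univ, true_and, not_lt] at hl
      linarith [hle l]
  · refine subset_convexHull ℝ _ ⟨l, ?_, rfl⟩
    have : q l < k l := by simpa using hl
    simp [J, this]

end Final

theorem statement5 (n : ℕ) (hn : 0 < n) (K : Set (Fin n → ℝ)) (hK : IsComplex K)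
    (w : Fin n → ℤ) (hw : toR w ∈ K) (hmin : ∀ q ∈ K, toR w ≤ q)
    (hpl : ∀ v : Fin n → ℤ, toR v ∈ K → v ≠ w → ContractibleSpace ↥(geomReal K v)) :
    ∀ k : Fin n → ℤ, toR k ∈ K →
      ContractibleSpace ↥(DipathSpace K (toR w) (toR k)) := by
  classical
  have hwle : ∀ k : Fin n → ℤ, toR k ∈ K → w ≤ k := by
    intro k hk i
    have := hmin _ hk i
    simp only [toR] at this
    exact_mod_cast this
  suffices H : ∀ (N : ℕ) (k : Fin n → ℤ), (∑ i, (k i - w i)).toNat = N → toR k ∈ K →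
      ContractibleSpace ↥(DipathSpace K (toR w) (toR k)) from fun k hk => H _ k rfl hk
  intro N
  induction N using Nat.strong_induction_on with
  | _ N IH =>
    intro k hN hk
    have hwk := hwle k hk
    by_cases hne : w = k
    · subst hne
      have : Nonempty ↥(DipathSpace K (toR w) (toR w)) :=
        ⟨⟨ContinuousMap.const _ (toR w), fun _ => hw, rfl, rfl, monotone_const⟩⟩
      have : Subsingleton ↥(DipathSpace K (toR w) (toR w)) := by
        have hc : ∀ (γ : ↥(DipathSpace K (toR w) (toR w))) t, γ.1 t = toR w := fun γ t =>
          le_antisymm ((γ.2.2.2.2 (unitInterval.le_one' : t ≤ 1)).trans γ.2.2.2.1.le)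
            (hmin _ (γ.2.1 t))
        exact ⟨fun γ γ' => Subtype.ext (ContinuousMap.ext fun t => (hc γ t).trans (hc γ' t).symm)⟩
      infer_instance
    · obtain ⟨q, hqc, hqt, hqs, hqu⟩ := exists_cross (K := K) hwk hne
      have hqK : ∀ γ, q γ ∈ K := by
        intro γ
        obtain ⟨t, ht⟩ := hqt γ
        rw [← ht]; exact γ.2.1 t
      have hqle : ∀ γ i, q γ i ≤ k i := by
        intro γ i
        obtain ⟨t, ht⟩ := hqt γ
        have := γ.2.2.2.2 (unitInterval.le_one' : t ≤ 1) i
        rw [← ht]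
        rw [γ.2.2.2.1] at this
        exact this
      have hS := hpl k hk (Ne.symm hne)
      let p : C(↥(DipathSpace K (toR w) (toR k)), ↥(geomReal K k)) :=
        ⟨fun γ => ⟨fun i => 2 * q γ i - k i, mem_geomReal hK.cl (hqK γ) (hqle γ) (hqs γ)⟩,
          Continuous.subtype_mk (continuous_pi fun i =>
            (continuous_const.mul ((continuous_apply i).comp hqc)).sub continuous_const) _⟩
      refine nerve p (fun z i => (k i : ℝ) - z.1 i) ?_ ?_ ?_ ?_
      · exact continuous_pi fun i =>
          continuous_const.sub ((continuous_apply i).comp continuous_subtype_val)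
      · exact fun z i => sub_nonneg.2 ((geomReal_spec z.2).1 i)
      · exact fun z => (geomReal_spec z.2).2.1
      · rintro j ⟨i0, hi0⟩ ⟨z, hz⟩
        obtain ⟨-, -, J, hJ, hJ1⟩ := geomReal_spec z.2
        let k' : Fin n → ℤ := fun i => k i - if i ∈ j then 1 else 0
        have hcube : Icc (toR k') (toR k) ⊆ K := by
          refine Subset.trans (Icc_subset_Icc_left fun i => ?_) hJ.2.2
          simp only [toR, k', Pi.sub_apply]
          by_cases hi : i ∈ j
          · rw [hJ1 i (sub_pos.1 (hz i hi))]; simp [hi]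
          · rcases hJ.1 i with h | h <;> simp [hi, h]
        have hk'k : toR k' ≤ toR k := by
          intro i
          simp only [toR, k']
          by_cases hi : i ∈ j <;> simp [hi]
        have hk' : toR k' ∈ K := hcube ⟨le_refl _, hk'k⟩
        have hwk' := hwle k' hk'
        have hlt : (∑ i, (k' i - w i)).toNat < N := by
          have h1 : 0 ≤ ∑ i, (k' i - w i) :=
            Finset.sum_nonneg fun i _ => sub_nonneg.2 (hwk' i)
          have h2 : ∑ i, (k' i - w i) < ∑ i, (k i - w i) := by
            refine Finset.sum_lt_sum (fun i _ => ?_) ⟨i0, Finset.mem_univ _, ?_⟩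
            · simp only [k']
              split_ifs <;> omega
            · simp only [k', hi0, if_true]
              omega
          omega
        have := IH _ hlt k' rfl hk'
        have hmain := star_contractible hK.cl hwk' j (fun _ => rfl) hcube q hqc hqt hqs hqu
        have hset : {γ : ↥(DipathSpace K (toR w) (toR k)) | ∀ i ∈ j, 0 < (k i : ℝ) - (p γ).1 i}
            = {γ | ∀ i ∈ j, q γ i < k i} := by
          ext γ
          refine forall_congr' fun i => forall_congr' fun _ => ?_
          change 0 < (k i : ℝ) - (2 * q γ i - k i) ↔ _
          constructor <;> intro h <;> linarith
        rw [hset]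
        exact hmain

end DCC
end

section
/- Let K be a Euclidean cubical complex in ℝⁿ and let τ, σ be cubes of K such that τ is a free face of σ. Then (τ, σ) is an LPDC pair if and only if min σ ∉ τ (the minimum vertex of σ is not a vertex of τ). -/
open Set

namespace DCC

set_option linter.unusedSectionVars false

/-- The field with two elements. -/
def F2 : Type := ZMod 2

noncomputable instance : Field F2 := inferInstanceAs (Field (ZMod 2))

lemma two_F2 : (2 : F2) = 0 := (by decide : (2 : ZMod 2) = 0)

lemma add_self2 {M : Type*} [AddCommGroup M] [Module F2 M] (x : M) : x + x = 0 := by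
  rw [← two_smul F2 x, two_F2, zero_smul]

lemma sub_eq_add2 {M : Type*} [AddCommGroup M] [Module F2 M] (x y : M) : x - y = x + y := by
  rw [sub_eq_iff_eq_add, add_assoc, add_self2, add_zero]

abbrev Ch (V : Type*) := Finset V →₀ F2

/-- mod 2 augmented simplicial boundary -/
noncomputable def bd {V : Type*} [DecidableEq V] : Ch V →ₗ[F2] Ch V :=
  Finsupp.linearCombination (F2) (fun s => ∑ x ∈ s, Finsupp.single (s.erase x) (1 : F2))

noncomputable def cone {V : Type*} [DecidableEq V] (c : V) : Ch V →ₗ[F2] Ch V :=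
  Finsupp.linearCombination (F2)
    (fun s => if c ∈ s then 0 else Finsupp.single (insert c s) (1 : F2))

noncomputable abbrev sg {V : Type*} (s : Finset V) : Ch V := Finsupp.single s (1 : F2)

section chains
variable {V W U : Type*} [DecidableEq V] [DecidableEq W] [DecidableEq U]

lemma bd_sg (s : Finset V) : bd (sg s) = ∑ x ∈ s, sg (s.erase x) := by
  simp [bd, sg]

lemma bd_empty : bd (sg (∅ : Finset V)) = 0 := by simp [bd_sg]

lemma cone_sg (c : V) (s : Finset V) : cone c (sg s) = if c ∈ s then 0 else sg (insert c s) := by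
  simp [cone, sg]

lemma lin_ext {F G : Ch V →ₗ[F2] Ch W} (h : ∀ s, F (sg s) = G (sg s)) : F = G := by
  apply Finsupp.lhom_ext'
  intro s
  ext1
  exact h s

/-- chains supported on a family -/
noncomputable abbrev CC (Γ : Set (Finset V)) : Submodule (F2) (Ch V) :=
  Finsupp.supported (F2) (F2) Γ

lemma sg_mem {Γ : Set (Finset V)} {s : Finset V} (h : s ∈ Γ) : sg s ∈ CC Γ :=
  Finsupp.single_mem_supported _ _ h

lemma supp_mem {Γ : Set (Finset V)} {F : Ch V →ₗ[F2] Ch W} {P : Submodule (F2) (Ch W)}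
    (h : ∀ s ∈ Γ, F (sg s) ∈ P) {z : Ch V} (hz : z ∈ CC Γ) : F z ∈ P := by
  have : CC Γ ≤ P.comap F := by
    rw [CC, Finsupp.supported_eq_span_single, Submodule.span_le]
    rintro _ ⟨s, hs, rfl⟩
    exact h s hs
  exact this hz

lemma supp_eq {Γ : Set (Finset V)} {F G : Ch V →ₗ[F2] Ch W}
    (h : ∀ s ∈ Γ, F (sg s) = G (sg s)) {z : Ch V} (hz : z ∈ CC Γ) : F z = G z := by
  have := supp_mem (F := F - G) (P := ⊥) (Γ := Γ) (fun s hs => by simp [h s hs]) hz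
  simpa [sub_eq_zero] using this

lemma cone_bd (c : V) (z : Ch V) : bd (cone c z) + cone c (bd z) = z := by
  have : bd ∘ₗ cone c + cone c ∘ₗ bd = LinearMap.id := by
    apply lin_ext
    intro s
    simp only [LinearMap.add_apply, LinearMap.comp_apply, LinearMap.id_apply, cone_sg]
    by_cases hc : c ∈ s
    · rw [if_pos hc, map_zero, zero_add, bd_sg, map_sum, Finset.sum_eq_single c]
      · rw [cone_sg]; simp [Finset.insert_erase hc]
      · intro b hb hbc
        rw [cone_sg, if_pos]
        simp [hc, hbc.symm]
      · intro h; exact absurd hc h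
    · rw [if_neg hc, bd_sg, bd_sg, Finset.sum_insert hc, map_sum, Finset.erase_insert hc, add_assoc,
        ← Finset.sum_add_distrib, Finset.sum_eq_zero, add_zero]
      intro x hx
      have hxc : c ≠ x := by rintro rfl; exact hc hx
      rw [cone_sg, if_neg (by simp [hc]), Finset.erase_insert_of_ne hxc]
      exact add_self2 _
  exact LinearMap.congr_fun this z

lemma bd_bd (z : Ch V) : bd (bd z) = 0 := by
  have : bd ∘ₗ bd = (0 : Ch V →ₗ[F2] Ch V) := by
    apply lin_ext
    intro s
    simp only [LinearMap.comp_apply, LinearMap.zero_apply]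
    induction s using Finset.induction_on with
    | empty => simp [bd_empty]
    | insert a s ha ih =>
      have h1 : sg (insert a s) = cone a (sg s) := by rw [cone_sg, if_neg ha]
      have h2 := cone_bd a (sg s)
      have h3 := cone_bd a (bd (sg s))
      rw [ih, map_zero, add_zero] at h3
      have h4 := congrArg bd h2
      rw [map_add, h3] at h4
      rw [h1]
      simpa using h4
  exact LinearMap.congr_fun this z

def Dn (Γ : Set (Finset V)) : Prop := ∀ s ∈ Γ, ∀ t, t ⊆ s → t ∈ Γ

def Acy (P : Submodule (F2) (Ch V)) : Prop := ∀ z ∈ P, bd z = 0 → ∃ w ∈ P, bd w = z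

lemma bd_mem {Γ : Set (Finset V)} (hΓ : Dn Γ) {z : Ch V} (hz : z ∈ CC Γ) : bd z ∈ CC Γ := by
  refine supp_mem (fun s hs => ?_) hz
  rw [bd_sg]
  exact Submodule.sum_mem _ fun x _ => sg_mem (hΓ s hs _ (Finset.erase_subset _ _))

lemma acy_full {t : Finset V} (ht : t.Nonempty) : Acy (CC {s | s ⊆ t}) := by
  obtain ⟨c, hc⟩ := ht
  intro z hz h
  refine ⟨cone c z, supp_mem (fun s hs => ?_) hz, ?_⟩
  · rw [cone_sg]
    split_ifs
    · exact Submodule.zero_mem _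
    · exact sg_mem (Finset.insert_subset hc hs)
  · have := cone_bd c z
    rwa [h, map_zero, add_zero] at this

open Classical in
noncomputable def solveFun (R : Ch V →ₗ[F2] Ch W) (Φ : Finset V → Submodule (F2) (Ch W))
    (s : Finset V) : Ch W :=
  if h : s.Nonempty ∧ ∃ w ∈ Φ s, bd w = R (sg s) + ∑ x ∈ s.attach, solveFun R Φ (s.erase x) then
    h.2.choose else 0
termination_by s.card
decreasing_by exact Finset.card_erase_lt_of_mem x.2

lemma solve {Γ : Set (Finset V)} (hΓ : Dn Γ) (R : Ch V →ₗ[F2] Ch W)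
    (Φ : Finset V → Submodule (F2) (Ch W))
    (hmono : ∀ s ∈ Γ, ∀ t, t ⊆ s → Φ t ≤ Φ s)
    (hacy : ∀ s ∈ Γ, s.Nonempty → Acy (Φ s))
    (hR0 : R (sg ∅) = 0) (hR : ∀ s ∈ Γ, bd (R (sg s)) = R (bd (sg s)))
    (hRΦ : ∀ s ∈ Γ, R (sg s) ∈ Φ s) :
    ∃ D : Ch V →ₗ[F2] Ch W, D (sg ∅) = 0 ∧ (∀ s ∈ Γ, D (sg s) ∈ Φ s) ∧
      ∀ s ∈ Γ, bd (D (sg s)) + D (bd (sg s)) = R (sg s) := by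
  let D : Ch V →ₗ[F2] Ch W := Finsupp.linearCombination (F2) (solveFun R Φ)
  have hD : ∀ s, D (sg s) = solveFun R Φ s := by intro s; simp [D, sg]
  have hDb : ∀ s, D (bd (sg s)) = ∑ x ∈ s.attach, solveFun R Φ (s.erase x) := by
    intro s
    rw [bd_sg, map_sum, ← Finset.sum_attach]
    exact Finset.sum_congr rfl fun x _ => hD _
  have hD0 : D (sg ∅) = 0 := by
    rw [hD, solveFun, dif_neg]; simp
  have key : ∀ k : ℕ, ∀ s ∈ Γ, s.card = k → D (sg s) ∈ Φ s ∧
      bd (D (sg s)) + D (bd (sg s)) = R (sg s) := by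
    intro k
    induction k using Nat.strong_induction_on with
    | _ k ih =>
    intro s hs hk
    rcases s.eq_empty_or_nonempty with rfl | hne
    · rw [hD0, hR0, bd_empty]; simp
    have hex : ∃ w ∈ Φ s, bd w = R (sg s) + D (bd (sg s)) := by
      apply hacy s hs hne
      · refine Submodule.add_mem _ (hRΦ s hs) ?_
        rw [bd_sg, map_sum]
        refine Submodule.sum_mem _ fun x hx => ?_
        have hsub := Finset.erase_subset x s
        exact hmono s hs _ hsub
          ((ih _ (hk ▸ Finset.card_erase_lt_of_mem hx) _ (hΓ s hs _ hsub) rfl).1)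
      · have h1 : bd (D (bd (sg s))) + D (bd (bd (sg s))) = R (bd (sg s)) := by
          rw [bd_sg]
          simp only [map_sum]
          rw [← Finset.sum_add_distrib]
          refine Finset.sum_congr rfl fun x hx => ?_
          have hsub := Finset.erase_subset x s
          have := (ih _ (hk ▸ Finset.card_erase_lt_of_mem hx) _ (hΓ s hs _ hsub) rfl).2
          simpa only [map_sum] using this
        rw [bd_bd, map_zero, add_zero] at h1
        rw [map_add, hR s hs, h1]
        exact add_self2 _
    have hcond : s.Nonempty ∧ ∃ w ∈ Φ s, bd w = R (sg s) +
        ∑ x ∈ s.attach, solveFun R Φ (s.erase x) := ⟨hne, by rw [← hDb]; exact hex⟩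
    have hval : D (sg s) = hcond.2.choose := by
      rw [hD, solveFun, dif_pos hcond]
    obtain ⟨h1, h2⟩ := hcond.2.choose_spec
    rw [← hval, ← hDb] at h2
    rw [← hval] at h1
    refine ⟨h1, ?_⟩
    rw [h2, add_assoc, add_self2, add_zero]
  exact ⟨D, hD0, fun s hs => (key _ s hs rfl).1, fun s hs => (key _ s hs rfl).2⟩

def IsCh (F : Ch V →ₗ[F2] Ch W) (Γ : Set (Finset V)) : Prop :=
  F (sg ∅) = sg ∅ ∧ ∀ s ∈ Γ, bd (F (sg s)) = F (bd (sg s))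

lemma IsCh.bd {F : Ch V →ₗ[F2] Ch W} {Γ : Set (Finset V)} (h : IsCh F Γ) {z : Ch V}
    (hz : z ∈ CC Γ) : bd (F z) = F (bd z) :=
  supp_eq (F := DCC.bd ∘ₗ F) (G := F ∘ₗ DCC.bd) (fun s hs => h.2 s hs) hz

lemma IsCh.comp {F : Ch V →ₗ[F2] Ch W} {G : Ch W →ₗ[F2] Ch U} {Γ : Set (Finset V)}
    {Γ' : Set (Finset W)} (hF : IsCh F Γ) (hG : IsCh G Γ') (h : ∀ s ∈ Γ, F (sg s) ∈ CC Γ') :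
    IsCh (G ∘ₗ F) Γ := by
  refine ⟨by simp [hF.1, hG.1], fun s hs => ?_⟩
  simp only [LinearMap.comp_apply]
  rw [hG.bd (h s hs), hF.2 s hs]

lemma exists_chain {Γ : Set (Finset V)} (hΓ : Dn Γ)
    (Φ : Finset V → Submodule (F2) (Ch W))
    (hmono : ∀ s ∈ Γ, ∀ t, t ⊆ s → Φ t ≤ Φ s)
    (hacy : ∀ s ∈ Γ, s.Nonempty → Acy (Φ s))
    (h0 : ∀ s, sg ∅ ∈ Φ s) :
    ∃ F : Ch V →ₗ[F2] Ch W, IsCh F Γ ∧ ∀ s ∈ Γ, F (sg s) ∈ Φ s := by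
  let F0 : Ch V →ₗ[F2] Ch W :=
    Finsupp.linearCombination (F2) (fun s => if s = ∅ then sg ∅ else 0)
  have hF0 : ∀ s, F0 (sg s) = if s = ∅ then sg ∅ else 0 := by intro s; simp [F0, sg]
  have hF0m : ∀ s t, F0 (sg s) ∈ Φ t := by
    intro s t; rw [hF0]; split_ifs
    · exact h0 t
    · exact Submodule.zero_mem _
  have hbF0 : ∀ s, bd (F0 (sg s)) = 0 := by
    intro s; rw [hF0]; split_ifs
    · exact bd_empty
    · simp
  obtain ⟨D, hD0, hDΦ, hD⟩ := solve hΓ (bd ∘ₗ F0 + F0 ∘ₗ bd) Φ hmono hacy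
    (by simp [hbF0, bd_empty]) (by intro s hs; simp [bd_bd]) (by
      intro s hs
      simp only [LinearMap.add_apply, LinearMap.comp_apply, hbF0, zero_add]
      rw [bd_sg, map_sum]
      exact Submodule.sum_mem _ fun x hx => hF0m _ _)
  refine ⟨F0 + D, ⟨by simp [hD0, hF0], fun s hs => ?_⟩, fun s hs =>
    Submodule.add_mem _ (hF0m _ _) (hDΦ s hs)⟩
  have := hD s hs
  simp only [LinearMap.add_apply, LinearMap.comp_apply, map_add] at this ⊢
  have e : bd (D (sg s)) = (bd (F0 (sg s)) + F0 (bd (sg s))) - D (bd (sg s)) := by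
    rw [← this]; abel
  rw [e, sub_eq_add2, ← add_assoc, ← add_assoc, add_self2, zero_add]

lemma homologous {Γ : Set (Finset V)} (hΓ : Dn Γ)
    (Φ : Finset V → Submodule (F2) (Ch W))
    (hmono : ∀ s ∈ Γ, ∀ t, t ⊆ s → Φ t ≤ Φ s)
    (hacy : ∀ s ∈ Γ, s.Nonempty → Acy (Φ s))
    {F G : Ch V →ₗ[F2] Ch W} (hF : IsCh F Γ) (hG : IsCh G Γ)
    (hFΦ : ∀ s ∈ Γ, F (sg s) ∈ Φ s) (hGΦ : ∀ s ∈ Γ, G (sg s) ∈ Φ s)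
    {P : Submodule (F2) (Ch W)} (hP : ∀ s ∈ Γ, Φ s ≤ P)
    {z : Ch V} (hz : z ∈ CC Γ) (hzc : bd z = 0) : ∃ w ∈ P, bd w = F z + G z := by
  obtain ⟨D, hD0, hDΦ, hD⟩ := solve hΓ (F + G) Φ hmono hacy
    (by simp [hF.1, hG.1, add_self2]) (by intro s hs; simp [hF.2 s hs, hG.2 s hs])
    (fun s hs => Submodule.add_mem _ (hFΦ s hs) (hGΦ s hs))
  refine ⟨D z, supp_mem (fun s hs => hP s hs (hDΦ s hs)) hz, ?_⟩
  have := supp_eq (F := bd ∘ₗ D + D ∘ₗ bd) (G := F + G) hD hz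
  simpa [hzc] using this

/-- carrier of a vertex map -/
noncomputable def car (f : V → W) (s : Finset V) : Submodule (F2) (Ch W) :=
  CC {t | t ⊆ s.image f}

lemma exists_push (f : V → W) : ∃ F : Ch V →ₗ[F2] Ch W, IsCh F univ ∧
    ∀ s, F (sg s) ∈ car f s := by
  obtain ⟨F, h1, h2⟩ := exists_chain (Γ := univ) (fun _ _ _ _ => trivial) (car f)
    (fun s _ t hts => Finsupp.supported_mono fun u hu =>
      Finset.Subset.trans hu (Finset.image_subset_image hts))
    (fun s _ hs => acy_full (hs.image f))
    (fun s => sg_mem (Finset.empty_subset _))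
  exact ⟨F, h1, fun s => h2 s trivial⟩

noncomputable def push (f : V → W) : Ch V →ₗ[F2] Ch W := (exists_push f).choose

lemma push_ch (f : V → W) (Γ : Set (Finset V)) : IsCh (push f) Γ :=
  ⟨(exists_push f).choose_spec.1.1, fun s _ => (exists_push f).choose_spec.1.2 s trivial⟩

lemma push_car (f : V → W) (s : Finset V) : push f (sg s) ∈ car f s :=
  (exists_push f).choose_spec.2 s

lemma car_le {f : V → W} {s : Finset V} {Γ' : Set (Finset W)} (h' : Dn Γ') (h : s.image f ∈ Γ') :
    car f s ≤ CC Γ' := Finsupp.supported_mono fun t ht => h' _ h t ht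

lemma push_mem {f : V → W} {Γ : Set (Finset V)} {Γ' : Set (Finset W)} (h' : Dn Γ')
    (h : ∀ s ∈ Γ, s.image f ∈ Γ') {z : Ch V} (hz : z ∈ CC Γ) : push f z ∈ CC Γ' :=
  supp_mem (fun s hs => car_le h' (h s hs) (push_car f s)) hz

lemma push_bd (f : V → W) (z : Ch V) : bd (push f z) = push f (bd z) :=
  (push_ch f univ).bd (by simp [CC])

/-- contiguous maps -/
lemma contig {Γ : Set (Finset V)} (hΓ : Dn Γ) {Γ' : Set (Finset W)} (h' : Dn Γ')
    {f g : V → W} (h : ∀ s ∈ Γ, s.image f ∪ s.image g ∈ Γ')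
    {F G : Ch V →ₗ[F2] Ch W} (hF : IsCh F Γ) (hG : IsCh G Γ)
    (hFc : ∀ s ∈ Γ, F (sg s) ∈ car f s) (hGc : ∀ s ∈ Γ, G (sg s) ∈ car g s)
    {z : Ch V} (hz : z ∈ CC Γ) (hzc : bd z = 0) : ∃ w ∈ CC Γ', bd w = F z + G z := by
  refine homologous hΓ (fun s => CC {t | t ⊆ s.image f ∪ s.image g}) ?_ ?_ hF hG ?_ ?_ ?_ hz hzc
  · exact fun s _ t hts => Finsupp.supported_mono fun u hu => Finset.Subset.trans hu
      (Finset.union_subset_union (Finset.image_subset_image hts) (Finset.image_subset_image hts))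
  · exact fun s _ hs => acy_full ((hs.image f).mono Finset.subset_union_left)
  · exact fun s hs => Finsupp.supported_mono (fun u hu => Finset.Subset.trans hu
      Finset.subset_union_left) (hFc s hs)
  · exact fun s hs => Finsupp.supported_mono (fun u hu => Finset.Subset.trans hu
      Finset.subset_union_right) (hGc s hs)
  · exact fun s hs => Finsupp.supported_mono fun t ht => h' _ (h s hs) t ht

lemma steps {Γ : Set (Finset V)} (hΓ : Dn Γ) {Γ' : Set (Finset W)} (h' : Dn Γ')
    (f : ℕ → V → W) (N : ℕ) (h : ∀ k < N, ∀ s ∈ Γ, s.image (f k) ∪ s.image (f (k + 1)) ∈ Γ')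
    {z : Ch V} (hz : z ∈ CC Γ) (hzc : bd z = 0) :
    ∃ w ∈ CC Γ', bd w = push (f 0) z + push (f N) z := by
  induction N with
  | zero => exact ⟨0, Submodule.zero_mem _, by rw [map_zero, add_self2]⟩
  | succ N ih =>
    obtain ⟨w, hw, e⟩ := ih fun k hk => h k (by omega)
    obtain ⟨w', hw', e'⟩ := contig hΓ h' (h N (by omega)) (push_ch (f N) Γ) (push_ch (f (N+1)) Γ)
      (fun s _ => push_car _ s) (fun s _ => push_car _ s) hz hzc
    refine ⟨w + w', Submodule.add_mem _ hw hw', ?_⟩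
    rw [map_add, e, e', add_assoc, ← add_assoc (push (f N) z), add_self2, zero_add]

lemma id_ch (Γ : Set (Finset V)) : IsCh (LinearMap.id : Ch V →ₗ[F2] Ch V) Γ :=
  ⟨rfl, fun _ _ => rfl⟩

end chains

section geom
variable {n : ℕ}

/-- Vietoris–Rips family of a subset of `ℝⁿ`. -/
def VR (δ : ℝ) (A : Set (Fin n → ℝ)) : Set (Finset (Fin n → ℝ)) :=
  {s | (∀ x ∈ s, x ∈ A) ∧ ∀ x ∈ s, ∀ y ∈ s, dist x y < δ}

lemma VR_dn (δ : ℝ) (A : Set (Fin n → ℝ)) : Dn (VR δ A) :=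
  fun _ hs _ ht => ⟨fun x hx => hs.1 x (ht hx), fun x hx y hy => hs.2 x (ht hx) y (ht hy)⟩

lemma VR_mono {δ δ' : ℝ} {A A' : Set (Fin n → ℝ)} (h : δ ≤ δ') (hA : A ⊆ A') :
    VR δ A ⊆ VR δ' A' :=
  fun _ hs => ⟨fun x hx => hA (hs.1 x hx), fun x hx y hy => (hs.2 x hx y hy).trans_le h⟩

lemma exists_margin {δ : ℝ} {A : Set (Fin n → ℝ)} {z : Ch (Fin n → ℝ)}
    (hz : z ∈ CC (VR δ A)) : ∃ δ' < δ, z ∈ CC (VR δ' A) := by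
  let T : Finset ℝ := z.support.biUnion fun s => (s ×ˢ s).image fun p => dist p.1 p.2
  have hT : ∀ r ∈ T, r < δ := by
    intro r hr
    simp only [T, Finset.mem_biUnion, Finset.mem_image, Finset.mem_product] at hr
    obtain ⟨s, hs, p, ⟨h1, h2⟩, rfl⟩ := hr
    exact (hz hs).2 _ h1 _ h2
  have : ∃ m < δ, ∀ r ∈ T, r ≤ m := by
    rcases T.eq_empty_or_nonempty with h | h
    · exact ⟨δ - 1, by linarith, by simp [h]⟩
    · exact ⟨T.max' h, hT _ (T.max'_mem h), fun r hr => T.le_max' r hr⟩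
  obtain ⟨m, hm, hTm⟩ := this
  refine ⟨(m + δ) / 2, by linarith, fun s hs => ⟨(hz hs).1, fun x hx y hy => ?_⟩⟩
  have : dist x y ∈ T := by
    simp only [T, Finset.mem_biUnion, Finset.mem_image, Finset.mem_product]
    exact ⟨s, hs, (x, y), ⟨hx, hy⟩, rfl⟩
  linarith [hTm _ this]

lemma star_acy {δ : ℝ} {A : Set (Fin n → ℝ)} (c : Fin n → ℝ) (hc : c ∈ A) (hδ : 0 < δ)
    (hstar : ∀ x ∈ A, ∀ t : ℝ, 0 ≤ t → t ≤ 1 → (1 - t) • x + t • c ∈ A)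
    (hbdd : ∀ x ∈ A, dist x c ≤ 1) : Acy (CC (VR δ A)) := by
  intro z hz hzc
  obtain ⟨δ', hδ', hz'⟩ := exists_margin hz
  obtain ⟨N, hN⟩ := exists_nat_one_div_lt (sub_pos.2 hδ')
  have hN0 : (0 : ℝ) < (N : ℝ) + 1 := by positivity
  let f : ℕ → (Fin n → ℝ) → (Fin n → ℝ) := fun k x =>
    (1 - (k : ℝ) / (N + 1)) • x + ((k : ℝ) / (N + 1)) • c
  have hfA : ∀ k ≤ N + 1, ∀ x ∈ A, f k x ∈ A := by
    intro k hk x hx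
    refine hstar x hx _ (by positivity) ?_
    rw [div_le_one hN0]; exact_mod_cast hk
  have hfd : ∀ k ≤ N + 1, ∀ l : ℕ, (l = k ∨ l = k + 1 ∨ k = l + 1) → ∀ x ∈ A, ∀ y ∈ A,
      dist x y < δ' → dist (f k x) (f l y) < δ := by
    intro k hk l hl x hx y hy hxy
    have e : f k x - f l y = (1 - (k : ℝ) / (N + 1)) • (x - y) +
        ((l : ℝ) / (N + 1) - (k : ℝ) / (N + 1)) • (y - c) := by
      simp only [f]; module
    rw [dist_eq_norm] at hxy ⊢
    have hyc := hbdd y hy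
    rw [dist_eq_norm] at hyc
    rw [e]
    have h1 : ‖(1 - (k : ℝ) / (N + 1))‖ ≤ 1 := by
      rw [Real.norm_eq_abs, abs_le]
      have : (k : ℝ) / (N + 1) ≤ 1 := by rw [div_le_one hN0]; exact_mod_cast hk
      have : 0 ≤ (k : ℝ) / (N + 1) := by positivity
      constructor <;> linarith
    have h2 : ‖((l : ℝ) / (N + 1) - (k : ℝ) / (N + 1))‖ ≤ 1 / (N + 1) := by
      rw [← sub_div, norm_div, Real.norm_eq_abs, Real.norm_eq_abs, abs_of_pos hN0]
      apply div_le_div_of_nonneg_right _ hN0.le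
      rcases hl with rfl | rfl | rfl <;> simp
    calc _ ≤ ‖(1 - (k : ℝ) / (N + 1))‖ * ‖x - y‖ +
        ‖((l : ℝ) / (N + 1) - (k : ℝ) / (N + 1))‖ * ‖y - c‖ := by
          rw [← norm_smul, ← norm_smul]; exact norm_add_le _ _
      _ ≤ 1 * ‖x - y‖ + 1 / (N + 1) * 1 := by gcongr
      _ < δ := by linarith
  have f0 : ∀ x, f 0 x = x := by intro x; simp [f]
  have fN : ∀ x, f (N + 1) x = c := by
    intro x; simp only [f]; push_cast; rw [div_self hN0.ne']; simp
  obtain ⟨w, hw, ew⟩ := steps (VR_dn δ' A) (VR_dn δ A) f (N + 1) (by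
    intro k hk s hs
    constructor
    · intro x hx
      simp only [Finset.mem_union, Finset.mem_image] at hx
      rcases hx with ⟨y, hy, rfl⟩ | ⟨y, hy, rfl⟩
      · exact hfA _ hk.le _ (hs.1 y hy)
      · exact hfA _ hk _ (hs.1 y hy)
    · intro x hx y hy
      simp only [Finset.mem_union, Finset.mem_image] at hx hy
      rcases hx with ⟨x', hx, rfl⟩ | ⟨x', hx, rfl⟩ <;>
      rcases hy with ⟨y', hy, rfl⟩ | ⟨y', hy, rfl⟩ <;>
      exact hfd _ (by omega) _ (by omega) _ (hs.1 _ hx) _ (hs.1 _ hy) (hs.2 _ hx _ hy)) hz' hzc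
  obtain ⟨w1, hw1, ew1⟩ := contig (VR_dn δ' A) (VR_dn δ A) (f := id) (g := f 0) (by
      intro s hs
      have : s.image (f 0) = s := by
        rw [show f 0 = id from funext f0]; simp
      rw [this, Finset.image_id, Finset.union_self]
      exact VR_mono hδ'.le subset_rfl hs) (id_ch _) (push_ch (f 0) _)
      (fun s _ => by simp only [car, Finset.image_id]; exact sg_mem (Finset.Subset.refl s))
      (fun s _ => push_car _ _) hz' hzc
  have h3 : push (f (N + 1)) z ∈ CC {t : Finset (Fin n → ℝ) | t ⊆ {c}} := by
    refine push_mem (Γ := VR δ' A) (fun s hs t ht => Finset.Subset.trans ht hs) (fun s _ => ?_) hz'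
    intro x hx
    obtain ⟨y, _, rfl⟩ := Finset.mem_image.1 hx
    simp [fN]
  obtain ⟨w2, hw2, ew2⟩ := acy_full (Finset.singleton_nonempty c) _ h3
    (by rw [push_bd, hzc, map_zero])
  refine ⟨w1 + (w + w2), Submodule.add_mem _ hw1 (Submodule.add_mem _ hw
    (Finsupp.supported_mono ?_ hw2)), ?_⟩
  · intro t ht
    have ht' : ∀ x ∈ t, x = c := fun x hx => by simpa using ht hx
    refine ⟨fun x hx => by rw [ht' x hx]; exact hc, fun x hx y hy => ?_⟩
    rw [ht' x hx, ht' y hy, dist_self]; exact hδ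
  · rw [map_add, map_add, ew, ew1, ew2]
    simp only [LinearMap.id_apply]
    rw [add_assoc (push (f 0) z), add_self2, add_zero, add_assoc, add_self2,
      add_zero]

/-- support of a point -/
noncomputable def sp (x : Fin n → ℝ) : Finset (Fin n) := Finset.univ.filter fun i => x i ≠ 0

lemma mem_sp {x : Fin n → ℝ} {i : Fin n} : i ∈ sp x ↔ x i ≠ 0 := by simp [sp]

/-- realization of a simplicial complex in the standard simplex -/
def rl (L : Set (Finset (Fin n))) : Set (Fin n → ℝ) :=
  {x | (∀ i, 0 ≤ x i) ∧ ∑ i, x i = 1 ∧ sp x ∈ L}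

lemma rl_mono {L M : Set (Finset (Fin n))} (h : L ⊆ M) : rl L ⊆ rl M :=
  fun _ hx => ⟨hx.1, hx.2.1, h hx.2.2⟩

lemma rl_le_one {L : Set (Finset (Fin n))} {x : Fin n → ℝ} (hx : x ∈ rl L) (i : Fin n) :
    x i ≤ 1 := by
  rw [← hx.2.1]
  exact Finset.single_le_sum (fun j _ => hx.1 j) (Finset.mem_univ i)

lemma single_rl {L : Set (Finset (Fin n))} {i : Fin n} (h : {i} ∈ L) :
    (Pi.single i 1 : Fin n → ℝ) ∈ rl L := by
  refine ⟨fun j => ?_, by simp, ?_⟩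
  · by_cases h : j = i
    · subst h; simp
    · simp [h]
  · have : sp (Pi.single i 1 : Fin n → ℝ) = {i} := by
      ext j; rw [mem_sp]; by_cases h : j = i
      · subst h; simp
      · simp [h]
    rwa [this]

lemma vr_acy {δ : ℝ} (hδ : 0 < δ) {Γ : Set (Finset (Fin n))} (hΓ : Dn Γ) (h0 : ∅ ∈ Γ) (i : Fin n)
    (hins : ∀ t ∈ Γ, insert i t ∈ Γ) : Acy (CC (VR δ (rl Γ))) := by
  have hi : (Pi.single i 1 : Fin n → ℝ) ∈ rl Γ := single_rl (by simpa using hins _ h0)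
  refine star_acy (Pi.single i 1) hi hδ ?_ ?_
  · intro x hx t ht0 ht1
    refine ⟨fun j => ?_, ?_, ?_⟩
    · have := hx.1 j
      have := hi.1 j
      simp only [Pi.add_apply, Pi.smul_apply, smul_eq_mul]
      have : 0 ≤ 1 - t := by linarith
      positivity
    · simp only [Pi.add_apply, Pi.smul_apply, smul_eq_mul, Finset.sum_add_distrib,
        ← Finset.mul_sum, hx.2.1, hi.2.1]
      ring
    · refine hΓ _ (hins _ hx.2.2) _ ?_
      intro j hj
      rw [mem_sp] at hj
      rw [Finset.mem_insert, mem_sp]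
      by_contra! hcon
      apply hj
      simp [hcon.1, hcon.2]
  · intro x hx
    rw [dist_pi_le_iff zero_le_one]
    intro j
    rw [Real.dist_eq, abs_le]
    have := hx.1 j
    have := hi.1 j
    have := rl_le_one hx j
    have := rl_le_one hi j
    constructor <;> linarith

open Classical in
noncomputable def ph (hn : 0 < n) (x : Fin n → ℝ) : Fin n :=
  if h : ∃ i, 1 / (n : ℝ) ≤ x i then h.choose else ⟨0, hn⟩

lemma ph_spec (hn : 0 < n) {L : Set (Finset (Fin n))} {x : Fin n → ℝ} (hx : x ∈ rl L) :
    1 / (n : ℝ) ≤ x (ph hn x) := by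
  have h : ∃ i, 1 / (n : ℝ) ≤ x i := by
    by_contra! hcon
    have : ∑ i, x i < ∑ i : Fin n, 1 / (n : ℝ) :=
      Finset.sum_lt_sum_of_nonempty ⟨⟨0, hn⟩, Finset.mem_univ _⟩ fun i _ => hcon i
    have hn' : (n : ℝ) ≠ 0 := by positivity
    rw [hx.2.1] at this
    simp [hn'] at this
  rw [ph, dif_pos h]
  exact h.choose_spec

lemma ph_sub (hn : 0 < n) {δ : ℝ} (hδ : δ ≤ 1 / n) {L : Set (Finset (Fin n))}
    {s : Finset (Fin n → ℝ)} (hs : s ∈ VR δ (rl L)) {x : Fin n → ℝ} (hx : x ∈ s) :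
    s.image (ph hn) ⊆ sp x := by
  intro i hi
  obtain ⟨y, hy, rfl⟩ := Finset.mem_image.1 hi
  rw [mem_sp]
  have h1 := ph_spec hn (hs.1 y hy)
  have h2 := (dist_le_pi_dist y x (ph hn y)).trans_lt (hs.2 y hy x hx)
  rw [Real.dist_eq, abs_lt] at h2
  intro h
  rw [h] at h2
  linarith [h2.2]

lemma ph_mem (hn : 0 < n) {δ : ℝ} (hδ : δ ≤ 1 / n) {L : Set (Finset (Fin n))} (hL : Dn L)
    (h0 : ∅ ∈ L) {s : Finset (Fin n → ℝ)} (hs : s ∈ VR δ (rl L)) : s.image (ph hn) ∈ L := by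
  rcases s.eq_empty_or_nonempty with rfl | ⟨x, hx⟩
  · simpa using h0
  · exact hL _ (hs.1 x hx).2.2 _ (ph_sub hn hδ hs hx)

lemma face_mono {s : Finset (Fin n)} {L : Set (Finset (Fin n))} (hL : Dn L) (hs : s ∈ L) :
    {t | t ⊆ s} ⊆ L := fun t ht => hL s hs t ht

lemma face_dn (s : Finset (Fin n)) : Dn {t | t ⊆ s} := fun _ ha _ hb => Finset.Subset.trans hb ha

/-- subdivision map -/
lemma exists_psi {δ : ℝ} (hδ : 0 < δ) {L : Set (Finset (Fin n))} (hL : Dn L) :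
    ∃ F : Ch (Fin n) →ₗ[F2] Ch (Fin n → ℝ), IsCh F L ∧
      ∀ s ∈ L, F (sg s) ∈ CC (VR δ (rl {t | t ⊆ s})) := by
  refine exists_chain hL _ ?_ ?_ ?_
  · exact fun s _ t hts => Finsupp.supported_mono
      (VR_mono le_rfl (rl_mono fun u hu => Finset.Subset.trans hu hts))
  · rintro s _ ⟨i, hi⟩
    exact vr_acy hδ (face_dn s) (Finset.empty_subset s) i
      fun t ht => Finset.insert_subset hi ht
  · intro s
    exact sg_mem ⟨by simp, by simp⟩

lemma phi_psi (hn : 0 < n) {δ : ℝ} (hδ' : δ ≤ 1 / n) {L : Set (Finset (Fin n))}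
    (hL : Dn L) {ψ : Ch (Fin n) →ₗ[F2] Ch (Fin n → ℝ)} (hψ : IsCh ψ L)
    (hψc : ∀ s ∈ L, ψ (sg s) ∈ CC (VR δ (rl {t | t ⊆ s}))) {z : Ch (Fin n)} (hz : z ∈ CC L)
    (hzc : bd z = 0) : ∃ w ∈ CC L, bd w = push (ph hn) (ψ z) + z := by
  refine homologous (F := push (ph hn) ∘ₗ ψ) (G := LinearMap.id) hL
    (fun s => CC {t | t ⊆ s}) ?_ ?_ ?_ (id_ch _) ?_ ?_ ?_ hz hzc
  · exact fun s _ t hts => Finsupp.supported_mono fun u hu => Finset.Subset.trans hu hts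
  · exact fun s _ hs => acy_full hs
  · exact hψ.comp (push_ch _ univ) fun s hs => by simp [CC]
  · intro s hs
    exact push_mem (face_dn s)
      (fun u hu => ph_mem hn hδ' (face_dn s) (Finset.empty_subset s) hu) (hψc s hs)
  · exact fun s hs => sg_mem (Finset.Subset.refl s)
  · exact fun s hs => Finsupp.supported_mono (face_mono hL hs)

lemma psi_phi (hn : 0 < n) {δ : ℝ} (hδ : 0 < δ) (hδ' : δ ≤ 1 / n) {L : Set (Finset (Fin n))}
    (hL : Dn L) (h0 : ∅ ∈ L) {ψ : Ch (Fin n) →ₗ[F2] Ch (Fin n → ℝ)} (hψ : IsCh ψ L)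
    (hψc : ∀ s ∈ L, ψ (sg s) ∈ CC (VR δ (rl {t | t ⊆ s}))) {z : Ch (Fin n → ℝ)}
    (hz : z ∈ CC (VR δ (rl L)))
    (hzc : bd z = 0) : ∃ w ∈ CC (VR δ (rl L)), bd w = ψ (push (ph hn) z) + z := by
  let Θ : Finset (Fin n → ℝ) → Set (Finset (Fin n)) := fun s => {t | t = ∅ ∨ ∃ x ∈ s, t ⊆ sp x}
  have hΘd : ∀ s, Dn (Θ s) := by
    rintro s t (rfl | ⟨x, hx, h⟩) u hu
    · left; exact Finset.subset_empty.1 hu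
    · exact Or.inr ⟨x, hx, Finset.Subset.trans hu h⟩
  have hΘL : ∀ s ∈ VR δ (rl L), Θ s ⊆ L := by
    rintro s hs t (rfl | ⟨x, hx, h⟩)
    · exact h0
    · exact hL _ (hs.1 x hx).2.2 _ h
  refine homologous (F := ψ ∘ₗ push (ph hn)) (G := LinearMap.id) (VR_dn _ _)
    (fun s => CC (VR δ (rl (Θ s)))) ?_ ?_ ?_ (id_ch _) ?_ ?_ ?_ hz hzc
  · refine fun s _ t hts => Finsupp.supported_mono (VR_mono le_rfl (rl_mono ?_))
    rintro u (rfl | ⟨x, hx, h⟩)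
    · exact Or.inl rfl
    · exact Or.inr ⟨x, hts hx, h⟩
  · rintro s hs ⟨x, hx⟩
    have hp : ∀ y ∈ s, ph hn x ∈ sp y := fun y hy =>
      ph_sub hn hδ' hs hy (Finset.mem_image_of_mem _ hx)
    refine vr_acy hδ (hΘd s) (Or.inl rfl) (ph hn x) ?_
    rintro t (rfl | ⟨y, hy, h⟩)
    · exact Or.inr ⟨x, hx, by simpa using hp x hx⟩
    · exact Or.inr ⟨y, hy, Finset.insert_subset (hp y hy) h⟩
  · exact (push_ch (ph hn) _).comp hψ fun s hs => car_le hL (ph_mem hn hδ' hL h0 hs) (push_car _ s)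
  · intro s hs
    refine supp_mem (F := ψ) ?_ (push_car (ph hn) s)
    intro t ht
    have htL : t ∈ L := hL _ (ph_mem hn hδ' hL h0 hs) _ ht
    refine Finsupp.supported_mono (VR_mono le_rfl (rl_mono ?_)) (hψc t htL)
    intro u hu
    rcases s.eq_empty_or_nonempty with rfl | ⟨x, hx⟩
    · left
      have ht' : t = ∅ := by simpa using ht
      subst ht'
      exact Finset.subset_empty.1 hu
    · exact Or.inr ⟨x, hx, hu.trans (Finset.Subset.trans ht (ph_sub hn hδ' hs hx))⟩
  · intro s hs
    exact sg_mem ⟨fun x hx => ⟨(hs.1 x hx).1, (hs.1 x hx).2.1,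
      Or.inr ⟨x, hx, Finset.Subset.refl _⟩⟩, hs.2⟩
  · exact fun s hs => Finsupp.supported_mono (VR_mono le_rfl (rl_mono (hΘL s hs)))

end geom

section rank
variable {n : ℕ}

lemma dominated (hn : 0 < n) {L M : Set (Finset (Fin n))} (hL : Dn L) (hL0 : ∅ ∈ L)
    (hM : Dn M) (hM0 : ∅ ∈ M) (f g : (Fin n → ℝ) → (Fin n → ℝ))
    (hf : MapsTo f (rl L) (rl M)) (hg : MapsTo g (rl M) (rl L))
    (uf : ∀ ε > 0, ∃ δ > 0, ∀ x ∈ rl L, ∀ y ∈ rl L, dist x y < δ → dist (f x) (f y) < ε)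
    (ug : ∀ ε > 0, ∃ δ > 0, ∀ x ∈ rl M, ∀ y ∈ rl M, dist x y < δ → dist (g x) (g y) < ε)
    (hom : ∀ ε > 0, ∃ δ > 0, ∃ N : ℕ, ∃ h : ℕ → (Fin n → ℝ) → (Fin n → ℝ),
      (∀ x ∈ rl L, h 0 x = g (f x)) ∧ (∀ x ∈ rl L, h N x = x) ∧
      (∀ k, MapsTo (h k) (rl L) (rl L)) ∧
      ∀ k, ∀ x ∈ rl L, ∀ y ∈ rl L, dist x y < δ →
        dist (h k x) (h k y) < ε ∧ dist (h k x) (h (k + 1) y) < ε) :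
    ∃ A B : Ch (Fin n) →ₗ[F2] Ch (Fin n),
      (∀ z ∈ CC L, A z ∈ CC M ∧ bd (A z) = A (bd z)) ∧
      (∀ z ∈ CC M, B z ∈ CC L ∧ bd (B z) = B (bd z)) ∧
      ∀ z ∈ CC L, bd z = 0 → ∃ w ∈ CC L, bd w = B (A z) + z := by
  have hn1 : (0 : ℝ) < 1 / n := by positivity
  obtain ⟨δg, hδg, ug'⟩ := ug _ hn1
  obtain ⟨δM, hδM, hδM1, hδM2⟩ : ∃ δM > 0, δM ≤ δg ∧ δM ≤ 1 / (n : ℝ) :=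
    ⟨min δg (1 / n), lt_min hδg hn1, min_le_left _ _, min_le_right _ _⟩
  obtain ⟨δf, hδf, uf'⟩ := uf _ hδM
  obtain ⟨δh, hδh, N, h, h0, hN, hm, hd⟩ := hom _ hn1
  obtain ⟨δL, hδL, hδL1, hδL2, hδL3⟩ :
      ∃ δL > 0, δL ≤ δf ∧ δL ≤ δh ∧ δL ≤ 1 / (n : ℝ) :=
    ⟨min δf (min δh (1 / n)), lt_min hδf (lt_min hδh hn1), min_le_left _ _,
      (min_le_right _ _).trans (min_le_left _ _), (min_le_right _ _).trans (min_le_right _ _)⟩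
  obtain ⟨ψL, hψL, hψLc⟩ := exists_psi hδL hL
  obtain ⟨ψM, hψM, hψMc⟩ := exists_psi hδM hM
  have hψL' : ∀ z ∈ CC L, ψL z ∈ CC (VR δL (rl L)) := fun z hz => supp_mem
    (fun s hs => Finsupp.supported_mono (VR_mono le_rfl (rl_mono (face_mono hL hs))) (hψLc s hs)) hz
  have hψM' : ∀ z ∈ CC M, ψM z ∈ CC (VR δM (rl M)) := fun z hz => supp_mem
    (fun s hs => Finsupp.supported_mono (VR_mono le_rfl (rl_mono (face_mono hM hs))) (hψMc s hs)) hz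
  have hf' : ∀ s ∈ VR δL (rl L), s.image f ∈ VR δM (rl M) := by
    intro s hs
    constructor
    · intro x hx
      obtain ⟨y, hy, rfl⟩ := Finset.mem_image.1 hx
      exact hf (hs.1 y hy)
    · intro x hx x' hx'
      obtain ⟨y, hy, rfl⟩ := Finset.mem_image.1 hx
      obtain ⟨y', hy', rfl⟩ := Finset.mem_image.1 hx'
      exact uf' _ (hs.1 y hy) _ (hs.1 _ hy') ((hs.2 _ hy _ hy').trans_le hδL1)
  have hg' : ∀ s ∈ VR δM (rl M), s.image g ∈ VR (1 / n) (rl L) := by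
    intro s hs
    constructor
    · intro x hx
      obtain ⟨y, hy, rfl⟩ := Finset.mem_image.1 hx
      exact hg (hs.1 y hy)
    · intro x hx x' hx'
      obtain ⟨y, hy, rfl⟩ := Finset.mem_image.1 hx
      obtain ⟨y', hy', rfl⟩ := Finset.mem_image.1 hx'
      exact ug' _ (hs.1 y hy) _ (hs.1 _ hy') ((hs.2 _ hy _ hy').trans_le hδM1)
  have hφL : ∀ δ ≤ 1 / (n : ℝ), ∀ z ∈ CC (VR δ (rl L)), push (ph hn) z ∈ CC L := fun δ hδ z hz =>
    push_mem hL (fun s hs => ph_mem hn hδ hL hL0 hs) hz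
  have hφM : ∀ z ∈ CC (VR δM (rl M)), push (ph hn) z ∈ CC M := fun z hz =>
    push_mem hM (fun s hs => ph_mem hn hδM2 hM hM0 hs) hz
  have hfc : ∀ z ∈ CC (VR δL (rl L)), push f z ∈ CC (VR δM (rl M)) := fun z hz =>
    push_mem (VR_dn _ _) hf' hz
  have hgc : ∀ z ∈ CC (VR δM (rl M)), push g z ∈ CC (VR (1 / n) (rl L)) := fun z hz =>
    push_mem (VR_dn _ _) hg' hz
  have hh : ∀ k, ∀ s ∈ VR δL (rl L),
      s.image (h k) ∪ s.image (h (k + 1)) ∈ VR (1 / n) (rl L) := by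
    intro k s hs
    constructor
    · intro x hx
      simp only [Finset.mem_union, Finset.mem_image] at hx
      rcases hx with ⟨y, hy, rfl⟩ | ⟨y, hy, rfl⟩
      · exact hm _ (hs.1 y hy)
      · exact hm _ (hs.1 y hy)
    · intro x hx y hy
      simp only [Finset.mem_union, Finset.mem_image] at hx hy
      rcases hx with ⟨x', hx, rfl⟩ | ⟨x', hx, rfl⟩ <;>
      rcases hy with ⟨y', hy, rfl⟩ | ⟨y', hy, rfl⟩
      · exact (hd k _ (hs.1 _ hx) _ (hs.1 _ hy) ((hs.2 _ hx _ hy).trans_le hδL2)).1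
      · exact (hd k _ (hs.1 _ hx) _ (hs.1 _ hy) ((hs.2 _ hx _ hy).trans_le hδL2)).2
      · rw [dist_comm]
        exact (hd k _ (hs.1 _ hy) _ (hs.1 _ hx) ((hs.2 _ hy _ hx).trans_le hδL2)).2
      · exact (hd (k + 1) _ (hs.1 _ hx) _ (hs.1 _ hy) ((hs.2 _ hx _ hy).trans_le hδL2)).1
  have hhm : ∀ k, ∀ s ∈ VR δL (rl L), s.image (h k) ∪ s.image (h k) ∈ VR (1 / n) (rl L) := by
    intro k s hs
    rw [Finset.union_self]
    exact VR_dn _ _ _ (hh k s hs) _ Finset.subset_union_left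
  have hi0 : ∀ s ∈ VR δL (rl L), (s.image f).image g = s.image (h 0) := by
    intro s hs
    rw [Finset.image_image]
    exact Finset.image_congr fun x hx => (h0 x (hs.1 x hx)).symm
  have hiN : ∀ s ∈ VR δL (rl L), s.image (h N) = s := by
    intro s hs
    conv_rhs => rw [← Finset.image_id (s := s)]
    exact Finset.image_congr fun x hx => (hN x (hs.1 x hx))
  refine ⟨push (ph hn) ∘ₗ push f ∘ₗ ψL, push (ph hn) ∘ₗ push g ∘ₗ ψM, ?_, ?_, ?_⟩
  · intro z hz
    refine ⟨hφM _ (hfc _ (hψL' z hz)), ?_⟩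
    simp only [LinearMap.comp_apply]
    rw [push_bd, push_bd, hψL.bd hz]
  · intro z hz
    refine ⟨hφL _ le_rfl _ (hgc _ (hψM' z hz)), ?_⟩
    simp only [LinearMap.comp_apply]
    rw [push_bd, push_bd, hψM.bd hz]
  · intro z hz hzc
    simp only [LinearMap.comp_apply]
    set u := ψL z with hu
    have huc : u ∈ CC (VR δL (rl L)) := hψL' z hz
    have hub : bd u = 0 := by rw [hu, hψL.bd hz, hzc, map_zero]
    have hu1 := hfc u huc
    have hu1b : bd (push f u) = 0 := by rw [push_bd, hub, map_zero]
    obtain ⟨w1, hw1, e1⟩ := psi_phi hn hδM hδM2 hM hM0 hψM hψMc hu1 hu1b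
    obtain ⟨w2, hw2, e2⟩ := contig (F := push g ∘ₗ push f) (G := push (h 0)) (VR_dn _ _) (VR_dn _ _)
      (hhm 0) ((push_ch f _).comp (push_ch g univ) fun s hs => by simp [CC]) (push_ch _ _)
      (by
        intro s hs
        simp only [LinearMap.comp_apply]
        refine supp_mem (fun t ht => ?_) (push_car f s)
        refine Finsupp.supported_mono ?_ (push_car g t)
        intro v hv
        show v ⊆ _
        rw [← hi0 s hs]
        exact Finset.Subset.trans hv (Finset.image_subset_image ht))
      (fun s _ => push_car _ _) huc hub
    obtain ⟨w3, hw3, e3⟩ := steps (VR_dn _ _) (VR_dn _ _) h N (fun k _ => hh k) huc hub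
    obtain ⟨w4, hw4, e4⟩ := contig (F := push (h N)) (G := LinearMap.id) (VR_dn _ _) (VR_dn _ _)
      (hhm N) (push_ch _ _) (id_ch _) (fun s _ => push_car _ _)
      (by
        intro s hs
        simp only [LinearMap.id_apply, car]
        rw [hiN s hs]
        exact sg_mem (Finset.Subset.refl s)) huc hub
    obtain ⟨w5, hw5, e5⟩ := phi_psi hn hδL3 hL hψL hψLc hz hzc
    refine ⟨push (ph hn) (push g w1 + (w2 + (w3 + w4))) + w5, Submodule.add_mem _
      (hφL _ le_rfl _ (Submodule.add_mem _ (hgc _ hw1)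
        (Submodule.add_mem _ hw2 (Submodule.add_mem _ hw3 hw4)))) hw5, ?_⟩
    rw [map_add, push_bd, map_add, push_bd, e1, map_add bd, map_add bd, e2, e3, e4, e5]
    simp only [LinearMap.comp_apply, LinearMap.id_apply, map_add, ← hu]
    generalize push (ph hn) (push g (ψM (push (ph hn) (push f u)))) = a
    generalize push (ph hn) (push g (push f u)) = b
    generalize push (ph hn) (push (h 0) u) = c
    generalize push (ph hn) (push (h N) u) = d
    generalize push (ph hn) u = e
    have hb : b + b = 0 := add_self2 _
    have hc : c + c = 0 := add_self2 _
    have hd : d + d = 0 := add_self2 _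
    have he : e + e = 0 := add_self2 _
    calc _ = (a + z) + (b + b) + (c + c) + (d + d) + (e + e) := by abel
      _ = _ := by rw [hb, hc, hd, he]; simp

section linalg
open Module
variable {k X : Type*} [Field k] [AddCommGroup X] [Module k X]

/-- cycles in a subcomplex -/
def ZZ (d : X →ₗ[k] X) (C : Submodule k X) : Submodule k X := C ⊓ LinearMap.ker d

/-- boundaries in a subcomplex -/
def BB (d : X →ₗ[k] X) (C : Submodule k X) : Submodule k X := C.map d

lemma BB_le {d : X →ₗ[k] X} {C : Submodule k X} (h : ∀ x ∈ C, d x ∈ C) (h2 : ∀ x, d (d x) = 0) :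
    BB d C ≤ ZZ d C := by
  rintro _ ⟨w, hw, rfl⟩
  exact ⟨h w hw, h2 w⟩

lemma rank_add [FiniteDimensional k X] (d : X →ₗ[k] X) (C : Submodule k X) :
    finrank k (BB d C) + finrank k (ZZ d C) = finrank k C := by
  have h := LinearMap.finrank_range_add_finrank_ker (d.domRestrict C)
  have h1 : LinearMap.range (d.domRestrict C) = BB d C := by
    rw [LinearMap.range_domRestrict]; rfl
  have h2 : finrank k (LinearMap.ker (d.domRestrict C)) = finrank k (ZZ d C) := by
    have e : LinearMap.ker (d.domRestrict C) = (ZZ d C).comap C.subtype := by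
      ext x
      simp [ZZ]
    rw [e]
    exact (Submodule.comapSubtypeEquivOfLe (p := ZZ d C) (q := C) inf_le_left).finrank_eq
  rw [← h1, ← h2]
  exact h

/-- rank of homology of a subcomplex -/
noncomputable def hq (d : X →ₗ[k] X) (C : Submodule k X) : ℕ :=
  finrank k (ZZ d C ⧸ (BB d C).comap (ZZ d C).subtype)

lemma hq_add [FiniteDimensional k X] {d : X →ₗ[k] X} {C : Submodule k X}
    (h : ∀ x ∈ C, d x ∈ C) (h2 : ∀ x, d (d x) = 0) :
    hq d C + finrank k (BB d C) = finrank k (ZZ d C) := by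
  rw [← Submodule.finrank_quotient_add_finrank ((BB d C).comap (ZZ d C).subtype), hq,
    (Submodule.comapSubtypeEquivOfLe (BB_le h h2)).finrank_eq]

lemma hq_parity [FiniteDimensional k X] {d : X →ₗ[k] X} {C : Submodule k X}
    (h : ∀ x ∈ C, d x ∈ C) (h2 : ∀ x, d (d x) = 0) : hq d C % 2 = finrank k C % 2 := by
  have := rank_add d C
  have := hq_add h h2
  omega

lemma hq_le [FiniteDimensional k X] {d : X →ₗ[k] X} {C C' : Submodule k X} {A B : X →ₗ[k] X}
    (hA : ∀ z ∈ C, A z ∈ C' ∧ d (A z) = A (d z))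
    (hB : ∀ z ∈ C', B z ∈ C ∧ d (B z) = B (d z))
    (hBA : ∀ z ∈ C, d z = 0 → ∃ w ∈ C, d w = B (A z) - z) : hq d C ≤ hq d C' := by
  have hZ : ∀ z ∈ ZZ d C, A z ∈ ZZ d C' := by
    rintro z ⟨h1, h2⟩
    refine ⟨(hA z h1).1, ?_⟩
    change d (A z) = 0
    change d z = 0 at h2
    rw [(hA z h1).2, h2, map_zero]
  let A' : ZZ d C →ₗ[k] ZZ d C' := A.restrict hZ
  have hle : (BB d C).comap (ZZ d C).subtype ≤ ((BB d C').comap (ZZ d C').subtype).comap A' := by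
    rintro ⟨z, hz⟩ ⟨w, hw, e⟩
    exact ⟨A w, (hA w hw).1, by rw [(hA w hw).2, e]; rfl⟩
  refine LinearMap.finrank_le_finrank_of_injective
    (f := Submodule.mapQ _ _ A' hle) ?_
  rw [← LinearMap.ker_eq_bot, Submodule.ker_mapQ, ← le_bot_iff, Submodule.map_le_iff_le_comap,
    Submodule.comap_bot, Submodule.ker_mkQ]
  rintro ⟨z, hz⟩ ⟨w, hw, e⟩
  change d w = A z at e
  have hz2 : d z = 0 := hz.2
  obtain ⟨u, hu, e'⟩ := hBA z hz.1 hz2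
  refine ⟨B w - u, Submodule.sub_mem _ (hB w hw).1 hu, ?_⟩
  rw [map_sub, (hB w hw).2, e, e', sub_sub_cancel]
  rfl

end linalg

noncomputable def hh (L : Set (Finset (Fin n))) : ℕ := hq (bd (V := Fin n)) (CC L)

lemma hh_parity {L : Set (Finset (Fin n))} (hL : Dn L) : hh L % 2 = L.ncard % 2 := by
  have h3 : Module.finrank F2 (CC L) = L.ncard := by
    classical
    rw [(Finsupp.supportedEquivFinsupp (M := F2) (R := F2) L).finrank_eq,
      Module.finrank_finsupp_self, ← Set.toFinset_card, Set.ncard_eq_toFinset_card']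
  rw [← h3]
  exact hq_parity (fun x hx => bd_mem hL hx) bd_bd

lemma hh_le {L M : Set (Finset (Fin n))} {A B : Ch (Fin n) →ₗ[F2] Ch (Fin n)}
    (hA : ∀ z ∈ CC L, A z ∈ CC M ∧ bd (A z) = A (bd z))
    (hB : ∀ z ∈ CC M, B z ∈ CC L ∧ bd (B z) = B (bd z))
    (hBA : ∀ z ∈ CC L, bd z = 0 → ∃ w ∈ CC L, bd w = B (A z) + z) : hh L ≤ hh M := by
  refine hq_le (A := A) (B := B) hA hB fun z hz hzc => ?_
  obtain ⟨w, hw, e⟩ := hBA z hz hzc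
  exact ⟨w, hw, by rw [e, sub_eq_add2]⟩

lemma rl_compact (L : Set (Finset (Fin n))) (hL : Dn L) : IsCompact (rl L) := by
  have : rl L = ⋃ s ∈ L, (stdSimplex ℝ (Fin n) ∩ {x | ∀ i, i ∉ s → x i = 0}) := by
    ext x
    simp only [mem_iUnion, mem_inter_iff, mem_ofPred_eq, exists_prop]
    constructor
    · rintro ⟨h1, h2, h3⟩
      exact ⟨sp x, h3, ⟨h1, h2⟩, fun i hi => by simpa [mem_sp] using hi⟩
    · rintro ⟨s, hs, ⟨h1, h2⟩, h3⟩
      refine ⟨h1, h2, hL s hs _ fun i hi => ?_⟩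
      by_contra h
      exact (mem_sp.1 hi) (h3 i h)
  rw [this]
  refine (Set.toFinite L).isCompact_biUnion fun s _ => (isCompact_stdSimplex ℝ (Fin n)).inter_right ?_
  simp only [ofPred_forall]
  exact isClosed_iInter fun i => isClosed_iInter fun _ =>
    isClosed_eq (continuous_apply i) continuous_const

lemma hh_le_of_equiv (hn : 0 < n) {L M : Set (Finset (Fin n))} (hL : Dn L) (hL0 : ∅ ∈ L)
    (hM : Dn M) (hM0 : ∅ ∈ M) (e : ContinuousMap.HomotopyEquiv (rl L) (rl M)) : hh L ≤ hh M := by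
  classical
  have cL : CompactSpace (rl L) := isCompact_iff_compactSpace.1 (rl_compact L hL)
  have cM : CompactSpace (rl M) := isCompact_iff_compactSpace.1 (rl_compact M hM)
  let f : (Fin n → ℝ) → (Fin n → ℝ) := fun x => if h : x ∈ rl L then (e.toFun ⟨x, h⟩ : _) else x
  let g : (Fin n → ℝ) → (Fin n → ℝ) := fun x => if h : x ∈ rl M then (e.invFun ⟨x, h⟩ : _) else x
  have hfv : ∀ x (h : x ∈ rl L), f x = e.toFun ⟨x, h⟩ := fun x h => dif_pos h
  have hgv : ∀ x (h : x ∈ rl M), g x = e.invFun ⟨x, h⟩ := fun x h => dif_pos h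
  obtain ⟨H⟩ := e.left_inv
  obtain ⟨A, B, hA, hB, hBA⟩ := dominated hn hL hL0 hM hM0 f g
    (fun x hx => by rw [hfv x hx]; exact Subtype.coe_prop _)
    (fun x hx => by rw [hgv x hx]; exact Subtype.coe_prop _)
    (by
      intro ε hε
      have hu := CompactSpace.uniformContinuous_of_continuous e.toFun.continuous
      obtain ⟨δ, hδ, h⟩ := Metric.uniformContinuous_iff.1 hu ε hε
      refine ⟨δ, hδ, fun x hx y hy hxy => ?_⟩
      rw [hfv x hx, hfv y hy]
      exact h (a := ⟨x, hx⟩) (b := ⟨y, hy⟩) hxy)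
    (by
      intro ε hε
      have hu := CompactSpace.uniformContinuous_of_continuous e.invFun.continuous
      obtain ⟨δ, hδ, h⟩ := Metric.uniformContinuous_iff.1 hu ε hε
      refine ⟨δ, hδ, fun x hx y hy hxy => ?_⟩
      rw [hgv x hx, hgv y hy]
      exact h (a := ⟨x, hx⟩) (b := ⟨y, hy⟩) hxy)
    (by
      intro ε hε
      have hu := CompactSpace.uniformContinuous_of_continuous H.continuous
      obtain ⟨δ, hδ, h⟩ := Metric.uniformContinuous_iff.1 hu ε hε
      obtain ⟨N, hN⟩ := exists_nat_one_div_lt hδ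
      have hN0 : (0 : ℝ) < (N : ℝ) + 1 := by positivity
      let T : ℕ → unitInterval := fun k => projIcc 0 1 (zero_le_one (α := ℝ)) ((k : ℝ) / (N + 1))
      have hT0 : T 0 = 0 := by simp [T]
      have hTN : T (N + 1) = 1 := by
        simp only [T]; push_cast; rw [div_self hN0.ne']; exact projIcc_right (zero_le_one (α := ℝ))
      have hTd : ∀ k, dist (T k) (T (k + 1)) < δ := by
        intro k
        have h1 : dist (T k) (T (k + 1)) ≤ dist ((k : ℝ) / (N + 1)) (((k + 1 : ℕ) : ℝ) / (N + 1)) := by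
          have := (LipschitzWith.projIcc (a := (0 : ℝ)) (b := 1) (zero_le_one (α := ℝ))).dist_le_mul
            ((k : ℝ) / (N + 1)) (((k + 1 : ℕ) : ℝ) / (N + 1))
          rw [NNReal.coe_one, one_mul] at this
          exact this
        refine h1.trans_lt ?_
        rw [Real.dist_eq, ← sub_div, abs_div, abs_of_pos hN0]
        simpa using hN
      refine ⟨δ, hδ, N + 1, fun k x => if hx : x ∈ rl L then (H (T k, ⟨x, hx⟩) : _) else x,
        ?_, ?_, ?_, ?_⟩
      · intro x hx
        have hfx : f x ∈ rl M := by rw [hfv x hx]; exact Subtype.coe_prop _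
        dsimp only
        rw [dif_pos hx, hgv _ hfx, hT0, H.apply_zero]
        simp [hfv x hx]
      · intro x hx
        dsimp only
        rw [dif_pos hx, hTN, H.apply_one]; rfl
      · intro k x hx
        dsimp only
        rw [dif_pos hx]; exact Subtype.coe_prop _
      · intro k x hx y hy hxy
        dsimp only
        rw [dif_pos hx, dif_pos hy, dif_pos hy]
        constructor
        · exact h (a := (T k, ⟨x, hx⟩)) (b := (T k, ⟨y, hy⟩)) (by
            rw [Prod.dist_eq]; exact max_lt (by simpa using hδ) hxy)
        · exact h (a := (T k, ⟨x, hx⟩)) (b := (T (k + 1), ⟨y, hy⟩)) (by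
            rw [Prod.dist_eq]; exact max_lt (hTd k) hxy))
  exact hh_le hA hB hBA

theorem parity (hn : 0 < n) {L M : Set (Finset (Fin n))} (hL : Dn L) (hL0 : ∅ ∈ L)
    (hM : Dn M) (hM0 : ∅ ∈ M) (e : ContinuousMap.HomotopyEquiv (rl L) (rl M)) :
    L.ncard % 2 = M.ncard % 2 := by
  rw [← hh_parity hL, ← hh_parity hM]
  have h1 := hh_le_of_equiv hn hL hL0 hM hM0 e
  have h2 := hh_le_of_equiv hn hM hM0 hL hL0 e.symm
  rw [le_antisymm h1 h2]

end rank

section deform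
variable {n : ℕ}

noncomputable def qq (S : Finset (Fin n)) (hS : S.Nonempty) (w : Fin n) (t : ℝ) (x : Fin n → ℝ) :
    Fin n → ℝ := fun i => x i - t * (if i ∈ S then S.inf' hS x else 0)
      + t * (if i = w then S.card * S.inf' hS x else 0)

lemma qq_cont (S : Finset (Fin n)) (hS : S.Nonempty) (w : Fin n) :
    Continuous fun p : ℝ × (Fin n → ℝ) => qq S hS w p.1 p.2 := by
  have hm : Continuous fun p : ℝ × (Fin n → ℝ) => S.inf' hS p.2 :=
    Continuous.finset_inf'_apply hS fun i _ => (continuous_apply i).comp continuous_snd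
  refine continuous_pi fun i => ?_
  unfold qq
  split_ifs <;> fun_prop

lemma collapse_equiv {L L' : Set (Finset (Fin n))} (hL : Dn L) (S0 S1 : Finset (Fin n)) (w : Fin n)
    (hS0 : S0.Nonempty) (hw1 : w ∈ S1) (hw0 : w ∉ S0) (hS1 : S1 ∈ L)
    (hmax : ∀ t ∈ L, S0 ⊆ t → t ⊆ S1) (hL' : ∀ t, t ∈ L' ↔ t ∈ L ∧ ¬ S0 ⊆ t) :
    Nonempty (ContinuousMap.HomotopyEquiv (rl L) (rl L')) := by
  have q0 : ∀ x, qq S0 hS0 w 0 x = x := by intro x; ext i; simp [qq]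
  have qm : ∀ t x, S0.inf' hS0 x = 0 → qq S0 hS0 w t x = x := by
    intro t x h; ext i; simp [qq, h]
  have m0 : ∀ x ∈ rl L, 0 ≤ S0.inf' hS0 x := fun x hx => by
    rw [Finset.le_inf'_iff]; exact fun i _ => hx.1 i
  have hq : ∀ t : ℝ, 0 ≤ t → t ≤ 1 → ∀ x ∈ rl L, qq S0 hS0 w t x ∈ rl L := by
    intro t ht0 ht1 x hx
    have hm := m0 x hx
    refine ⟨fun i => ?_, ?_, ?_⟩
    · unfold qq
      have h1 : t * (if i ∈ S0 then S0.inf' hS0 x else 0) ≤ x i := by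
        split_ifs with h
        · have := Finset.inf'_le x h
          nlinarith
        · simpa using hx.1 i
      have h2 : 0 ≤ t * (if i = w then S0.card * S0.inf' hS0 x else 0) := by
        split_ifs
        · positivity
        · simp
      linarith
    · unfold qq
      rw [Finset.sum_add_distrib, Finset.sum_sub_distrib, hx.2.1, ← Finset.mul_sum, ← Finset.mul_sum]
      simp
    · by_cases h0 : S0.inf' hS0 x = 0
      · rw [qm t x h0]; exact hx.2.2
      · have hpos : 0 < S0.inf' hS0 x := lt_of_le_of_ne hm (Ne.symm h0)
        have hsub : S0 ⊆ sp x := fun i hi => by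
          rw [mem_sp]
          exact (hpos.trans_le (Finset.inf'_le x hi)).ne'
        have hx1 := hmax _ hx.2.2 hsub
        refine hL _ hS1 _ fun i hi => ?_
        by_contra hi1
        rw [mem_sp] at hi
        apply hi
        have e1 : x i = 0 := by
          by_contra h; exact hi1 (hx1 (mem_sp.2 h))
        have e2 : i ∉ S0 := fun h => hi1 (hx1 (hsub h))
        have e3 : i ≠ w := by rintro rfl; exact hi1 hw1
        simp [qq, e1, e2, e3]
  have hq1 : ∀ x ∈ rl L, qq S0 hS0 w 1 x ∈ rl L' := by
    intro x hx
    obtain ⟨h1, h2, h3⟩ := hq 1 zero_le_one le_rfl x hx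
    refine ⟨h1, h2, (hL' _).2 ⟨h3, fun hsub => ?_⟩⟩
    obtain ⟨i, hi, e⟩ := Finset.exists_mem_eq_inf' hS0 x
    refine mem_sp.1 (hsub hi) ?_
    have hiw : i ≠ w := by rintro rfl; exact hw0 hi
    simp [qq, hi, hiw, e]
  have hLL : rl L' ⊆ rl L := rl_mono fun t ht => ((hL' t).1 ht).1
  have hfix : ∀ x ∈ rl L', qq S0 hS0 w 1 x = x := by
    intro x hx
    apply qm
    refine le_antisymm ?_ (m0 x (hLL hx))
    by_contra! hpos
    refine ((hL' _).1 hx.2.2).2 fun i hi => ?_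
    rw [mem_sp]
    exact (hpos.trans_le (Finset.inf'_le x hi)).ne'
  have hc := qq_cont S0 hS0 w
  let F : C(rl L, rl L') := ⟨fun x => ⟨qq S0 hS0 w 1 x, hq1 x x.2⟩, by
    refine Continuous.subtype_mk ?_ _
    exact hc.comp (continuous_const.prodMk continuous_subtype_val)⟩
  let G : C(rl L', rl L) := ⟨fun x => ⟨x, hLL x.2⟩, by
    exact Continuous.subtype_mk continuous_subtype_val _⟩
  refine ⟨⟨F, G, ⟨⟨⟨fun p => ⟨qq S0 hS0 w (1 - p.1) p.2, hq _ (by linarith [p.1.2.2])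
    (by linarith [p.1.2.1]) _ p.2.2⟩, ?_⟩, ?_, ?_⟩⟩, ?_⟩⟩
  · refine Continuous.subtype_mk ?_ _
    exact hc.comp ((continuous_const.sub (continuous_subtype_val.comp continuous_fst)).prodMk
      (continuous_subtype_val.comp continuous_snd))
  · intro x
    apply Subtype.ext
    simp [F, G]
  · intro x
    apply Subtype.ext
    simp [q0]
  · have : F.comp G = ContinuousMap.id _ := by
      ext1 x
      apply Subtype.ext
      exact hfix x x.2
    rw [this]

end deform

section cubes
variable {n : ℕ}

/-- indicator vector -/
def ind (s : Finset (Fin n)) : Fin n → ℤ := fun i => if i ∈ s then 1 else 0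

lemma ind_bin (s : Finset (Fin n)) : IsBinary (ind s) := by
  intro i; unfold ind; split_ifs <;> simp

/-- the past link as an augmented simplicial complex -/
def LK (K : Set (Fin n → ℝ)) (v : Fin n → ℤ) : Set (Finset (Fin n)) := {s | cube v (ind s) ⊆ K}

lemma toR_le {u v : Fin n → ℤ} : toR u ≤ toR v ↔ u ≤ v := by
  simp [toR, Pi.le_def]

lemma mem_cube {u v j : Fin n → ℤ} : toR u ∈ cube v j ↔ v - j ≤ u ∧ u ≤ v := by
  simp [cube, toR_le]

lemma bin_nonneg {j : Fin n → ℤ} (h : IsBinary j) : 0 ≤ j := by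
  intro i; rcases h i with h | h <;> simp [h]

lemma cube_sub {v j v' j' : Fin n → ℤ} (h : IsBinary j) :
    cube v j ⊆ cube v' j' ↔ v' - j' ≤ v - j ∧ v ≤ v' := by
  have hle : v - j ≤ v := by
    intro i; have := bin_nonneg h i; simp at this ⊢; exact this
  unfold cube
  rw [Icc_subset_Icc_iff (toR_le.2 hle), toR_le, toR_le]

lemma LK_dn (K : Set (Fin n → ℝ)) (v : Fin n → ℤ) : Dn (LK K v) := by
  intro s hs t hts
  refine Subset.trans ((cube_sub (ind_bin t)).2 ⟨?_, le_rfl⟩) hs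
  intro i
  simp only [Pi.sub_apply, ind]
  by_cases h : i ∈ t
  · simp [h, hts h]
  · split_ifs <;> simp

lemma cube_empty (v : Fin n → ℤ) : cube v (ind ∅) = {toR v} := by
  have : ind (∅ : Finset (Fin n)) = 0 := by ext i; simp [ind]
  simp [cube, this]

lemma empty_LK {K : Set (Fin n → ℝ)} {v : Fin n → ℤ} : ∅ ∈ LK K v ↔ toR v ∈ K := by
  change cube v (ind ∅) ⊆ K ↔ _
  rw [cube_empty, singleton_subset_iff]

lemma bin_ind {j : Fin n → ℤ} (h : IsBinary j) : j = ind (Finset.univ.filter fun i => j i = 1) := by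
  ext i
  rcases h i with h | h <;> simp [ind, h]

lemma geomReal_eq (K : Set (Fin n → ℝ)) (v : Fin n → ℤ) :
    geomReal K v = (Homeomorph.subLeft (toR v)) '' rl (LK K v) := by
  ext y
  simp only [geomReal, mem_iUnion, exists_prop, mem_image, Homeomorph.coe_subLeft]
  constructor
  · rintro ⟨j, ⟨hj, -, hjK⟩, hy⟩
    let T : Set (Fin n → ℝ) := {y | (∀ i, 0 ≤ toR v i - y i) ∧ ∑ i, (toR v i - y i) = 1 ∧
      ∀ i, j i ≠ 1 → toR v i - y i = 0}
    have hT : Convex ℝ T := by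
      rintro a ⟨a1, a2, a3⟩ b ⟨b1, b2, b3⟩ s t hs ht hst
      have key : ∀ i, toR v i - (s • a + t • b) i =
          s * (toR v i - a i) + t * (toR v i - b i) := by
        intro i
        simp only [Pi.add_apply, Pi.smul_apply, smul_eq_mul]
        linear_combination (- toR v i) * hst
      refine ⟨fun i => ?_, ?_, fun i hi => ?_⟩
      · rw [key]
        exact add_nonneg (mul_nonneg hs (a1 i)) (mul_nonneg ht (b1 i))
      · simp only [key]
        rw [Finset.sum_add_distrib, ← Finset.mul_sum, ← Finset.mul_sum, a2, b2]
        linarith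
      · rw [key, a3 i hi, b3 i hi]; simp
    have hmem : y ∈ T := by
      refine convexHull_min ?_ hT hy
      rintro _ ⟨i, hi, rfl⟩
      have hi' : j i = 1 := hi
      refine ⟨fun k => ?_, ?_, fun k hk => ?_⟩
      · by_cases h : k = i
        · subst h; simp
        · simp [h]
      · simp
      · have h : k ≠ i := by rintro rfl; exact hk hi'
        simp [h]
    refine ⟨toR v - y, ⟨hmem.1, hmem.2.1, ?_⟩, by simp⟩
    rw [bin_ind hj] at hjK
    refine LK_dn K v _ hjK _ fun i hi => ?_
    rw [mem_sp] at hi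
    by_contra h
    exact hi (hmem.2.2 i (by simpa using h))
  · rintro ⟨x, ⟨h1, h2, h3⟩, rfl⟩
    refine ⟨ind (sp x), ⟨ind_bin _, ?_, h3⟩, ?_⟩
    · intro h0
      have : ∀ i, x i = 0 := by
        intro i
        by_contra h
        have := congrFun h0 i
        simp [ind, mem_sp, h] at this
      simp [this] at h2
    · have hs : ∑ i ∈ sp x, x i = 1 := by
        rw [← h2]
        exact Finset.sum_subset (Finset.subset_univ _) fun i _ hi => by simpa [mem_sp] using hi
      have := (convex_convexHull ℝ ((fun i => toR v - Pi.single i (1 : ℝ)) ''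
        {i | ind (sp x) i = 1})).sum_mem (t := sp x) (w := x)
        (z := fun i => toR v - Pi.single i (1 : ℝ)) (fun i _ => h1 i) hs
        (fun i hi => subset_convexHull ℝ _ ⟨i, by simp [ind, hi], rfl⟩)
      convert this using 1
      simp only [smul_sub, Finset.sum_sub_distrib, ← Finset.sum_smul, hs, one_smul]
      congr 1
      ext k
      simp only [Finset.sum_apply, Pi.smul_apply, smul_eq_mul, Pi.single_apply, mul_ite, mul_one,
        mul_zero, Finset.sum_ite_eq]
      split_ifs with h
      · rfl
      · simpa [mem_sp] using h

noncomputable def geomHomeo (K : Set (Fin n → ℝ)) (v : Fin n → ℤ) :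
    rl (LK K v) ≃ₜ geomReal K v :=
  ((Homeomorph.subLeft (toR v)).image (rl (LK K v))).trans
    (Homeomorph.setCongr (geomReal_eq K v).symm)

lemma equiv_iff (K K' : Set (Fin n → ℝ)) (v : Fin n → ℤ) :
    Nonempty (ContinuousMap.HomotopyEquiv (geomReal K v) (geomReal K' v)) ↔
    Nonempty (ContinuousMap.HomotopyEquiv (rl (LK K v)) (rl (LK K' v))) := by
  constructor
  · rintro ⟨e⟩
    exact ⟨((geomHomeo K v).toHomotopyEquiv.trans e).trans (geomHomeo K' v).symm.toHomotopyEquiv⟩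
  · rintro ⟨e⟩
    exact ⟨((geomHomeo K v).symm.toHomotopyEquiv.trans e).trans (geomHomeo K' v).toHomotopyEquiv⟩

lemma generic {v j v' j' : Fin n → ℤ} (hj : IsBinary j)
    (h : (fun i => (v i : ℝ) - (j i : ℝ) / 2) ∈ cube v' j') : cube v j ⊆ cube v' j' := by
  rw [cube_sub hj]
  obtain ⟨h1, h2⟩ := h
  constructor <;> intro i
  · have := h1 i
    simp only [toR, Pi.sub_apply] at this ⊢
    rcases hj i with h | h
    · rw [h] at this ⊢
      have h' : ((v' i - j' i : ℤ) : ℝ) ≤ (v i : ℝ) := by simpa using this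
      have := Int.cast_le.1 h'
      omega
    · rw [h] at this ⊢
      have h' : ((v' i - j' i : ℤ) : ℝ) < (v i : ℝ) := by push_cast at this ⊢; linarith
      have := Int.cast_lt.1 h'
      omega
  · have := h2 i
    simp only [toR] at this ⊢
    have hj1 : (j i : ℝ) ≤ 1 := by rcases hj i with h | h <;> simp [h]
    have h' : ((v i : ℤ) : ℝ) < ((v' i + 1 : ℤ) : ℝ) := by push_cast; linarith
    have := Int.cast_lt.1 h'
    omega

lemma mid_mem {v j : Fin n → ℤ} (hj : IsBinary j) :
    (fun i => (v i : ℝ) - (j i : ℝ) / 2) ∈ cube v j := by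
  constructor <;> intro i <;> simp only [toR, Pi.sub_apply] <;>
    rcases hj i with h | h <;> rw [h] <;> push_cast <;> linarith

lemma collapse_iff {K τ : Set (Fin n → ℝ)} {v j : Fin n → ℤ} (hj : IsBinary j) :
    cube v j ⊆ collapse K τ ↔ cube v j ⊆ K ∧ ¬ τ ⊆ cube v j := by
  constructor
  · intro h
    obtain ⟨_, ⟨⟨v', j', _, rfl⟩, h1, h2⟩, h3⟩ := h (mid_mem hj)
    have := generic hj h3
    exact ⟨this.trans h1, fun hτ => h2 (hτ.trans this)⟩
  · rintro ⟨h1, h2⟩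
    exact fun x hx => ⟨_, ⟨⟨v, j, hj, rfl⟩, h1, h2⟩, hx⟩

lemma exists_max (K : Set (Fin n → ℝ)) (m : ℕ) : ∀ v j : Fin n → ℤ, IsBinary j → cube v j ⊆ K →
    (n : ℤ) - ∑ i, j i ≤ m → ∃ γ, IsMaximalCube K γ ∧ cube v j ⊆ γ := by
  induction m with
  | zero =>
    intro v j hj hK hm
    refine ⟨_, ⟨⟨v, j, hj, rfl⟩, hK, ?_⟩, subset_rfl⟩
    rintro _ ⟨v', j', hj', rfl⟩ hK' hsub
    obtain ⟨h1, h2⟩ := (cube_sub hj).1 hsub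
    have hjj : ∀ i, j i ≤ j' i := fun i => by
      have := h1 i; have := h2 i; simp only [Pi.sub_apply] at *; omega
    have hj1 : ∀ i, j i = j' i := by
      by_contra! hcon
      obtain ⟨i, hi⟩ := hcon
      have h3 : ∑ i, j i < ∑ i, j' i := Finset.sum_lt_sum (fun i _ => hjj i)
        ⟨i, Finset.mem_univ i, lt_of_le_of_ne (hjj i) hi⟩
      have h4 : ∑ i, j' i ≤ ∑ _i : Fin n, (1 : ℤ) := Finset.sum_le_sum fun i _ => by
        rcases hj' i with h | h <;> simp [h]
      simp at h4 hm
      omega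
    have ej : j = j' := funext hj1
    have ev : v = v' := by
      ext i; have := h1 i; have := h2 i; have := hj1 i; simp only [Pi.sub_apply] at *; omega
    rw [ej, ev]
  | succ m ih =>
    intro v j hj hK hm
    by_cases hmax : ∀ γ, IsElemCube γ → γ ⊆ K → cube v j ⊆ γ → γ = cube v j
    · exact ⟨_, ⟨⟨v, j, hj, rfl⟩, hK, hmax⟩, subset_rfl⟩
    push Not at hmax
    obtain ⟨_, ⟨v', j', hj', rfl⟩, hK', hsub, hne⟩ := hmax
    obtain ⟨h1, h2⟩ := (cube_sub hj).1 hsub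
    have hjj : ∀ i, j i ≤ j' i := fun i => by
      have := h1 i; have := h2 i; simp only [Pi.sub_apply] at *; omega
    have h3 : ∑ i, j i < ∑ i, j' i := by
      by_contra! hcon
      apply hne
      have hj1 : ∀ i, j i = j' i := by
        by_contra! hcon'
        obtain ⟨i, hi⟩ := hcon'
        exact absurd (Finset.sum_lt_sum (fun i _ => hjj i)
          ⟨i, Finset.mem_univ i, lt_of_le_of_ne (hjj i) hi⟩) (not_lt.2 hcon)
      have ej : j = j' := funext hj1
      have ev : v = v' := by
        ext i; have := h1 i; have := h2 i; have := hj1 i; simp only [Pi.sub_apply] at *; omega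
      rw [ej, ev]
    obtain ⟨γ, hγ, hsub'⟩ := ih v' j' hj' hK' (by push_cast at hm; omega)
    exact ⟨γ, hγ, hsub.trans hsub'⟩

lemma free_sub {K τ σ : Set (Fin n → ℝ)} (hfree : IsFreeFace K τ σ) {v j : Fin n → ℤ}
    (hj : IsBinary j) (hK : cube v j ⊆ K) (hτ : τ ⊆ cube v j) : cube v j ⊆ σ := by
  obtain ⟨γ, hγ, hsub⟩ := exists_max K ((n : ℤ) - ∑ i, j i).toNat v j hj hK (Int.self_le_toNat _)
  rw [← hfree.2.2.2 γ hγ (hτ.trans hsub)]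
  exact hsub

end cubes



lemma ind_cases (s : Finset (Fin n)) (i : Fin n) :
    (i ∈ s ∧ ind s i = 1) ∨ (i ∉ s ∧ ind s i = 0) := by
  by_cases h : i ∈ s <;> simp [ind, h]

theorem statement15 (n : ℕ) (hn : 0 < n) (K : Set (Fin n → ℝ)) (hK : IsComplex K)
    (vτ jτ vσ jσ : Fin n → ℤ) (hjτ : IsBinary jτ) (hjσ : IsBinary jσ)
    (hτK : cube vτ jτ ⊆ K) (hσK : cube vσ jσ ⊆ K)
    (hfree : IsFreeFace K (cube vτ jτ) (cube vσ jσ)) :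
    IsLPDCPair K (cube vτ jτ) ↔ toR (vσ - jσ) ∉ cube vτ jτ := by
  have hτσ := hfree.2.1
  obtain ⟨ha, hb⟩ := (cube_sub hjτ).1 hτσ.1
  have hmem : ∀ v t, t ∈ LK (collapse K (cube vτ jτ)) v ↔
      t ∈ LK K v ∧ ¬ cube vτ jτ ⊆ cube v (ind t) := fun v t => collapse_iff (ind_bin t)
  constructor
  · intro hL haτ
    obtain ⟨S, hS⟩ : ∃ S, jσ = ind S := ⟨_, bin_ind hjσ⟩
    subst hS
    obtain ⟨h1, h2⟩ := mem_cube.1 haτ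
    have hsub : ∀ t ∈ LK K vσ, cube vτ jτ ⊆ cube vσ (ind t) → t = S := by
      intro t ht hτ
      have h3 := ((cube_sub (ind_bin t)).1 (free_sub hfree (ind_bin t) ht hτ)).1
      have h4 := (mem_cube.1 (hτ haτ)).1
      ext i
      have h3 := h3 i
      have h4 := h4 i
      simp only [Pi.sub_apply] at h3 h4
      rcases ind_cases t i with ⟨h5, h6⟩ | ⟨h5, h6⟩ <;>
        rcases ind_cases S i with ⟨h7, h8⟩ | ⟨h7, h8⟩ <;> simp only [h5, h7] <;> omega
    have hSL : S ∈ LK K vσ := hσK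
    have h0 : ∅ ∈ LK K vσ := LK_dn K vσ S hSL _ (Finset.empty_subset _)
    have hLeq : LK (collapse K (cube vτ jτ)) vσ = LK K vσ \ {S} := by
      ext t
      rw [hmem]
      constructor
      · rintro ⟨h3, h4⟩
        exact ⟨h3, fun h => h4 (by rw [mem_singleton_iff.1 h]; exact hτσ.1)⟩
      · rintro ⟨h3, h4⟩
        exact ⟨h3, fun h => h4 (hsub t h3 h)⟩
    have hSne : ∅ ≠ S := by
      rintro rfl
      apply hτσ.2
      rw [cube_empty, singleton_subset_iff]
      have : vσ - ind ∅ = vσ := by ext i; simp [ind]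
      rwa [this] at haτ
    have h0' : ∅ ∈ LK (collapse K (cube vτ jτ)) vσ := by
      rw [hLeq]; exact ⟨h0, hSne⟩
    obtain ⟨e⟩ := (equiv_iff _ _ _).1 (hL vσ (empty_LK.1 h0'))
    have hp := parity hn (LK_dn _ _) h0 (LK_dn _ _) h0' e
    have hc := Set.ncard_diff_singleton_add_one hSL (Set.toFinite _)
    rw [hLeq] at hp
    omega
  · intro haτ v hv
    rw [equiv_iff]
    by_cases hex : ∃ s ∈ LK K v, cube vτ jτ ⊆ cube v (ind s)
    · obtain ⟨s, hs, hτs⟩ := hex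
      obtain ⟨h1, h2⟩ := (cube_sub (ind_bin s)).1 (free_sub hfree (ind_bin s) hs hτs)
      obtain ⟨h3, h4⟩ := (cube_sub hjτ).1 hτs
      have key : ∀ t, cube vτ jτ ⊆ cube v (ind t) ↔
          (Finset.univ.filter fun i => v i ≠ vτ i - jτ i) ⊆ t := by
        intro t
        rw [cube_sub hjτ]
        constructor
        · rintro ⟨h5, -⟩ i hi
          have hi := (Finset.mem_filter.1 hi).2
          have h5 := h5 i
          have h4 : vτ i ≤ v i := h4 i
          have h6 := bin_nonneg hjτ i
          simp only [Pi.sub_apply, Pi.zero_apply] at h5 h6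
          rcases ind_cases t i with ⟨h7, h8⟩ | ⟨h7, h8⟩
          · exact h7
          · omega
        · intro h
          refine ⟨fun i => ?_, h4⟩
          have h3 := h3 i
          simp only [Pi.sub_apply] at h3 ⊢
          rcases ind_cases t i with ⟨h7, h8⟩ | ⟨h7, h8⟩
          · rcases ind_cases s i with ⟨h9, h10⟩ | ⟨h9, h10⟩ <;> omega
          · have : ¬ v i ≠ vτ i - jτ i := fun h' =>
              h7 (h (Finset.mem_filter.2 ⟨Finset.mem_univ _, h'⟩))
            omega
      obtain ⟨w, hw⟩ : ∃ w, vσ w - jσ w < vτ w - jτ w := by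
        by_contra! hcon
        exact haτ (mem_cube.2 ⟨hcon, fun i => (ha i).trans (by
          have := bin_nonneg hjτ i
          simp only [Pi.sub_apply, Pi.zero_apply] at this ⊢
          omega)⟩)
      have hbin : ∀ i, vτ i - jτ i ≤ v i := fun i => by
        have h4 : vτ i ≤ v i := h4 i
        have h6 := bin_nonneg hjτ i
        simp only [Pi.zero_apply] at h6
        omega
      have hav : ∀ i, vσ i - jσ i ≤ v i := fun i => (ha i).trans (hbin i)
      have hvb : ∀ i, v i ≤ vσ i - jσ i + 1 := fun i => by
        have h2 : v i ≤ vσ i := h2 i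
        rcases hjσ i with h | h <;> omega
      have hind : ∀ t, cube v (ind t) ⊆ cube vσ jσ ↔
          t ⊆ Finset.univ.filter fun i => v i ≠ vσ i - jσ i := by
        intro t
        rw [cube_sub (ind_bin t)]
        constructor
        · rintro ⟨h5, -⟩ i hi
          have h5 := h5 i
          simp only [Pi.sub_apply] at h5
          refine Finset.mem_filter.2 ⟨Finset.mem_univ _, ?_⟩
          rcases ind_cases t i with ⟨h7, h8⟩ | ⟨h7, h8⟩
          · omega
          · exact absurd hi h7
        · intro h
          refine ⟨fun i => ?_, h2⟩
          have h9 := hav i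
          simp only [Pi.sub_apply]
          rcases ind_cases t i with ⟨h7, h8⟩ | ⟨h7, h8⟩
          · have := (Finset.mem_filter.1 (h h7)).2
            omega
          · omega
      refine collapse_equiv (LK_dn K v) (Finset.univ.filter fun i => v i ≠ vτ i - jτ i)
        (Finset.univ.filter fun i => v i ≠ vσ i - jσ i) w ?_ ?_ ?_ ?_ ?_ ?_
      · rw [Finset.nonempty_iff_ne_empty]
        intro h0
        have := ((hmem v ∅).1 (empty_LK.2 hv)).2
        exact this ((key ∅).2 h0.subset)
      · have := hbin w
        exact Finset.mem_filter.2 ⟨Finset.mem_univ _, by omega⟩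
      · have h5 := hbin w
        have h6 := hvb w
        intro h
        have := (Finset.mem_filter.1 h).2
        omega
      · exact ((hind _).2 subset_rfl).trans hσK
      · intro t ht h
        exact (hind t).1 (free_sub hfree (ind_bin t) ht ((key t).2 h))
      · intro t
        rw [hmem, key]
    · have : LK (collapse K (cube vτ jτ)) v = LK K v := by
        ext t
        rw [hmem]
        exact ⟨fun h => h.1, fun h => ⟨h, fun h' => hex ⟨t, h, h'⟩⟩⟩
      rw [this]
      exact ⟨ContinuousMap.HomotopyEquiv.refl _⟩

end DCC
end
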